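/- arXiv:2303.08381 — 4 statements merged into one kernel-verified Lean document; each statement's English description precedes it below -/
import Mathlib

section
/- Let x: U → ℝ³ be a smooth immersed surface with unit normal N and let f(p,t) = (x(p), t·N(p)) be the associated normal bundle immersion of U × ℝ into ℂ³ = ℝ³ × ℝ³. Then x is a minimal surface (the trace of its shape operator vanishes identically) if and only if f is a minimal immersion (its mean curvature vector H vanishes identically). -/
noncomputable section

open scoped InnerProductSpace

/-- Euclidean 3-space. -/
abbrev E3 : Type := EuclideanSpace ℝ (Fin 3)

/-- ℝ⁶ = ℝ³ × ℝ³, identified with ℂ³. -/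
abbrev V6 : Type := E3 × E3

/-- The domain of the normal bundle immersion: ℝ² × ℝ. -/
abbrev W3 : Type := (ℝ × ℝ) × ℝ

/-- The standard inner product on ℝ⁶ = ℝ³ × ℝ³. -/
def ip6 (v w : V6) : ℝ := ⟪v.1, w.1⟫_ℝ + ⟪v.2, w.2⟫_ℝ

/-- The complex structure J(X, Y) = (−Y, X) on ℝ³ × ℝ³ = ℂ³. -/
def Jc (v : V6) : V6 := (-v.2, v.1)

/-- The normal bundle immersion f(p, t) = (x(p), t·N(p)). -/
def nbi (x N : ℝ × ℝ → E3) : W3 → V6 := fun q => (x q.1, q.2 • N q.1)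

/-- Second derivative of `g` at `q` in directions `v`, `w`. -/
def d2 (g : W3 → V6) (q v w : W3) : V6 := fderiv ℝ (fun y => fderiv ℝ g y w) q v

/-- `n` is orthogonal to the tangent space (range of the differential) of `g` at `q`. -/
def IsNormalAt (g : W3 → V6) (q : W3) (n : V6) : Prop :=
  ∀ v : W3, ip6 n (fderiv ℝ g q v) = 0

/-- `n` is the second fundamental form `h(v, w)` of `g` at `q`: the orthogonal projection of
the second derivative in directions `v`, `w` onto the orthogonal complement of the tangent
space. -/
def IsSFF (g : W3 → V6) (q v w : W3) (n : V6) : Prop :=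
  IsNormalAt g q n ∧ d2 g q v w - n ∈ Set.range ⇑(fderiv ℝ g q)

/-- `v₁, v₂, v₃` is an orthonormal frame at `q` for the metric induced by `g`. -/
def ONFrame (g : W3 → V6) (q : W3) (v₁ v₂ v₃ : W3) : Prop :=
  ip6 (fderiv ℝ g q v₁) (fderiv ℝ g q v₁) = 1 ∧
  ip6 (fderiv ℝ g q v₂) (fderiv ℝ g q v₂) = 1 ∧
  ip6 (fderiv ℝ g q v₃) (fderiv ℝ g q v₃) = 1 ∧
  ip6 (fderiv ℝ g q v₁) (fderiv ℝ g q v₂) = 0 ∧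
  ip6 (fderiv ℝ g q v₁) (fderiv ℝ g q v₃) = 0 ∧
  ip6 (fderiv ℝ g q v₂) (fderiv ℝ g q v₃) = 0

/-- `Hq` is the mean curvature vector of `g` at `q`:
`H = Σᵢ h(ẽᵢ, ẽᵢ)` for an orthonormal frame `ẽ₁, ẽ₂, ẽ₃` of the induced metric. -/
def IsMeanCurvAt (g : W3 → V6) (q : W3) (Hq : V6) : Prop :=
  ∃ v₁ v₂ v₃ : W3, ONFrame g q v₁ v₂ v₃ ∧
    ∃ n₁ n₂ n₃ : V6, IsSFF g q v₁ v₁ n₁ ∧ IsSFF g q v₂ v₂ n₂ ∧ IsSFF g q v₃ v₃ n₃ ∧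
      Hq = n₁ + n₂ + n₃

/-- `u = A_ξ v`, the shape operator of `g` at `q` with respect to the normal vector `ξ`,
characterized by `⟨dg(A_ξ v), dg(w)⟩ = ⟨h(v, w), ξ⟩` for all `w`. -/
def IsShapeAt (g : W3 → V6) (q : W3) (ξ : V6) (v u : W3) : Prop :=
  ∀ w : W3, ∀ n : V6, IsSFF g q v w n →
    ip6 (fderiv ℝ g q u) (fderiv ℝ g q w) = ip6 n ξ

/-- `g` is a Lagrangian immersion at `q`: the differential is injective and `J` maps the
tangent space onto its orthogonal complement. -/
def LagrangianAt (g : W3 → V6) (q : W3) : Prop :=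
  Function.Injective ⇑(fderiv ℝ g q) ∧
    Jc '' Set.range ⇑(fderiv ℝ g q) =
      {u : V6 | ∀ w ∈ Set.range ⇑(fderiv ℝ g q), ip6 u w = 0}

/-- The Maslovian condition at `q` for the mean curvature vector `Hq`: `Hq ≠ 0` and
`A_H(JH)` is a real scalar multiple of `JH` (expressed via the tangent vector `V`
with `dg(V) = J Hq`). -/
def MaslovianAt (g : W3 → V6) (q : W3) (Hq : V6) : Prop :=
  Hq ≠ 0 ∧ ∀ V u : W3, fderiv ℝ g q V = Jc Hq → IsShapeAt g q Hq V u → ∃ c : ℝ, u = c • V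

/-- Standard hypotheses: `U` is a connected open set, `x` is a smooth immersion on `U`, and
`N` is a smooth unit normal field along `x` on `U`. -/
structure SurfaceData (U : Set (ℝ × ℝ)) (x N : ℝ × ℝ → E3) : Prop where
  open_U : IsOpen U
  conn_U : IsConnected U
  smooth_x : ContDiffOn ℝ (⊤ : ℕ∞) x U
  smooth_N : ContDiffOn ℝ (⊤ : ℕ∞) N U
  immersion : ∀ p ∈ U, Function.Injective ⇑(fderiv ℝ x p)
  unit_N : ∀ p ∈ U, ‖N p‖ = 1
  normal_N : ∀ p ∈ U, ∀ v : ℝ × ℝ, ⟪N p, fderiv ℝ x p v⟫_ℝ = 0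

/-- `x` is minimal at `p`: the trace of the shape operator `A = −dN ∘ dx⁻¹` vanishes,
expressed via orthonormal frames of the induced metric. -/
def SurfMinimalAt (x N : ℝ × ℝ → E3) (p : ℝ × ℝ) : Prop :=
  ∀ v₁ v₂ : ℝ × ℝ,
    ⟪fderiv ℝ x p v₁, fderiv ℝ x p v₁⟫_ℝ = 1 →
    ⟪fderiv ℝ x p v₂, fderiv ℝ x p v₂⟫_ℝ = 1 →
    ⟪fderiv ℝ x p v₁, fderiv ℝ x p v₂⟫_ℝ = 0 →
    ⟪fderiv ℝ N p v₁, fderiv ℝ x p v₁⟫_ℝ + ⟪fderiv ℝ N p v₂, fderiv ℝ x p v₂⟫_ℝ = 0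

/-- A rigid motion of ℝ³: `y ↦ S y + c` with `S ∈ SO(3)`. -/
def RigidMotion (Φ : E3 → E3) : Prop :=
  ∃ (S : E3 ≃ₗᵢ[ℝ] E3) (c : E3),
    LinearMap.det (S.toLinearEquiv : E3 →ₗ[ℝ] E3) = 1 ∧ ∀ y, Φ y = S y + c

/-- The circular cone `C_r = {(s·r·cos θ, s·r·sin θ, s)/√(r²+1) : s > 0, θ ∈ ℝ}`. -/
def coneSet (r : ℝ) : Set E3 :=
  { y | ∃ s θ : ℝ, 0 < s ∧
      y 0 = s * r * Real.cos θ / Real.sqrt (r ^ 2 + 1) ∧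
      y 1 = s * r * Real.sin θ / Real.sqrt (r ^ 2 + 1) ∧
      y 2 = s / Real.sqrt (r ^ 2 + 1) }

/-- `x(U)` is contained in a round sphere. -/
def InRoundSphere (U : Set (ℝ × ℝ)) (x : ℝ × ℝ → E3) : Prop :=
  ∃ (c : E3) (ρ : ℝ), 0 < ρ ∧ ∀ p ∈ U, ‖x p - c‖ = ρ

/-- `x(U)` is contained in a circular cylinder. -/
def InCircularCylinder (U : Set (ℝ × ℝ)) (x : ℝ × ℝ → E3) : Prop :=
  ∃ (c w : E3) (ρ : ℝ), ‖w‖ = 1 ∧ 0 < ρ ∧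
    ∀ p ∈ U, ‖(x p - c) - ⟪x p - c, w⟫_ℝ • w‖ = ρ

/-- `x(U)` is contained in a circular cone: the image under a rigid motion of `C_r`, `r ≠ 0`. -/
def InCircularCone (U : Set (ℝ × ℝ)) (x : ℝ × ℝ → E3) : Prop :=
  ∃ r : ℝ, r ≠ 0 ∧ ∃ Φ : E3 → E3, RigidMotion Φ ∧ ∀ p ∈ U, x p ∈ Φ '' coneSet r

theorem orthonormal_columns_of_rows {a₁ a₂ a₃ b₁ b₂ b₃ c₁ c₂ c₃ : ℝ}
    (h₁₁ : a₁ * a₁ + b₁ * b₁ + c₁ * c₁ = 1) (h₂₂ : a₂ * a₂ + b₂ * b₂ + c₂ * c₂ = 1)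
    (h₃₃ : a₃ * a₃ + b₃ * b₃ + c₃ * c₃ = 1) (h₁₂ : a₁ * a₂ + b₁ * b₂ + c₁ * c₂ = 0)
    (h₁₃ : a₁ * a₃ + b₁ * b₃ + c₁ * c₃ = 0) (h₂₃ : a₂ * a₃ + b₂ * b₃ + c₂ * c₃ = 0) :
    (a₁ * a₁ + a₂ * a₂ + a₃ * a₃ = 1 ∧ b₁ * b₁ + b₂ * b₂ + b₃ * b₃ = 1) ∧
      a₁ * b₁ + a₂ * b₂ + a₃ * b₃ = 0 ∧ a₁ * c₁ + a₂ * c₂ + a₃ * c₃ = 0 ∧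
      b₁ * c₁ + b₂ * c₂ + b₃ * c₃ = 0 := by
  have key : !![a₁, b₁, c₁; a₂, b₂, c₂; a₃, b₃, c₃] *
      !![a₁, a₂, a₃; b₁, b₂, b₃; c₁, c₂, c₃] = 1 := by
    ext i j
    fin_cases i <;> fin_cases j <;>
      simp [Matrix.mul_apply, Fin.sum_univ_three] <;> linarith
  have key' := mul_eq_one_comm.mp key
  have e := fun i j => congrFun (congrFun key' i) j
  have e₀₀ := e 0 0
  have e₁₁ := e 1 1
  have e₀₁ := e 0 1
  have e₀₂ := e 0 2
  have e₁₂ := e 1 2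
  simp [Matrix.mul_apply, Fin.sum_univ_three] at e₀₀ e₁₁ e₀₁ e₀₂ e₁₂
  exact ⟨⟨e₀₀, e₁₁⟩, e₀₁, e₀₂, e₁₂⟩

/-- An injective linear map from the plane onto the orthogonal complement of a unit vector `n`
admits a frame that is orthonormal for the induced metric. -/
theorem exists_induced_orthonormal_frame (A : ℝ × ℝ →L[ℝ] E3) (hA : Function.Injective A) (n : E3)
    (hn : ‖n‖ = 1) (hnA : ∀ v, ⟪n, A v⟫_ℝ = 0) :
    ∃ e₁ e₂ : ℝ × ℝ, ⟪A e₁, A e₁⟫_ℝ = 1 ∧ ⟪A e₂, A e₂⟫_ℝ = 1 ∧ ⟪A e₁, A e₂⟫_ℝ = 0 ∧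
      ∀ X : E3, ⟪n, X⟫_ℝ = 0 → X = A (⟪A e₁, X⟫_ℝ • e₁ + ⟪A e₂, X⟫_ℝ • e₂) := by
  let R := LinearMap.range A.toLinearMap
  have hdim : Module.finrank ℝ R = 2 := by
    rw [LinearMap.finrank_range_of_inj hA]; simp
  let b := (stdOrthonormalBasis ℝ R).reindex (finCongr hdim)
  obtain ⟨e₁, he₁⟩ : ∃ e, A e = b 0 := (b 0).2
  obtain ⟨e₂, he₂⟩ : ∃ e, A e = b 1 := (b 1).2
  have hb := orthonormal_iff_ite.mp b.orthonormal
  have h₁₁ : ⟪A e₁, A e₁⟫_ℝ = 1 := by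
    rw [he₁, ← Submodule.coe_inner, hb]; simp
  have h₂₂ : ⟪A e₂, A e₂⟫_ℝ = 1 := by
    rw [he₂, ← Submodule.coe_inner, hb]; simp
  have h₁₂ : ⟪A e₁, A e₂⟫_ℝ = 0 := by
    rw [he₁, he₂, ← Submodule.coe_inner, hb]; simp
  have h₂₁ : ⟪A e₂, A e₁⟫_ℝ = 0 := by rw [real_inner_comm]; exact h₁₂
  refine ⟨e₁, e₂, h₁₁, h₂₂, h₁₂, fun X hX => ?_⟩
  clear_value b
  have ho : Orthonormal ℝ ![A e₁, A e₂, n] := by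
    rw [orthonormal_iff_ite]
    have hnn : ⟪n, n⟫_ℝ = 1 := by rw [real_inner_self_eq_norm_sq, hn]; norm_num
    have hAn : ∀ v, ⟪A v, n⟫_ℝ = 0 := fun v => by rw [real_inner_comm]; exact hnA v
    intro i j
    fin_cases i <;> fin_cases j <;> simp [-inner_self_eq_norm_sq_to_K, h₁₁, h₂₂, h₁₂, h₂₁, hnn, hAn, hnA]
  let c := basisOfOrthonormalOfCardEqFinrank ho (by simp)
  have hc : ⇑c = ![A e₁, A e₂, n] := coe_basisOfOrthonormalOfCardEqFinrank ho (by simp)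
  let d := c.toOrthonormalBasis (by rw [hc]; exact ho)
  have hd : ⇑d = ![A e₁, A e₂, n] := by simp [d, hc]
  have := d.sum_repr' X
  rw [hd, Fin.sum_univ_three] at this
  simp [hX] at this
  simp [this]

/-- The first and second order structure equations of a surface with unit normal, where
`A`, `B` stand for the first derivatives and `A₂`, `B₂` for the second derivatives of the
surface and of its unit normal `n` at a point. -/
structure SurfaceJet (n : E3) (A B : ℝ × ℝ →L[ℝ] E3)
    (A₂ B₂ : ℝ × ℝ →L[ℝ] ℝ × ℝ →L[ℝ] E3) : Prop where
  inj : Function.Injective A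
  unit : ‖n‖ = 1
  normal : ∀ v, ⟪n, A v⟫_ℝ = 0
  tangent : ∀ v, ⟪n, B v⟫_ℝ = 0
  weingarten : ∀ v w, ⟪B v, A w⟫_ℝ + ⟪n, A₂ v w⟫_ℝ = 0
  symm_A₂ : ∀ v w, A₂ v w = A₂ w v
  symm_B₂ : ∀ v w, B₂ v w = B₂ w v
  codazzi : ∀ a b c, ⟪B₂ a b, A c⟫_ℝ + ⟪B b, A₂ a c⟫_ℝ = ⟪B₂ a c, A b⟫_ℝ + ⟪B c, A₂ a b⟫_ℝ

theorem SurfaceJet.symm {n : E3} {A B : ℝ × ℝ →L[ℝ] E3}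
    {A₂ B₂ : ℝ × ℝ →L[ℝ] ℝ × ℝ →L[ℝ] E3} (h : SurfaceJet n A B A₂ B₂) (v w : ℝ × ℝ) :
    ⟪B v, A w⟫_ℝ = ⟪B w, A v⟫_ℝ := by
  have h₁ := h.weingarten v w
  have h₂ := h.weingarten w v
  rw [h.symm_A₂] at h₂
  linarith

theorem ContDiffOn.hasFDerivAt_of_isOpen {U : Set (ℝ × ℝ)} (hU : IsOpen U) {g : ℝ × ℝ → E3}
    (hg : ContDiffOn ℝ (⊤ : ℕ∞) g U) {p : ℝ × ℝ} (hp : p ∈ U) :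
    HasFDerivAt g (fderiv ℝ g p) p :=
  ((hg.contDiffAt (hU.mem_nhds hp)).differentiableAt (by simp)).hasFDerivAt

theorem ContDiffOn.hasFDerivAt_fderiv_of_isOpen {U : Set (ℝ × ℝ)} (hU : IsOpen U) {g : ℝ × ℝ → E3}
    (hg : ContDiffOn ℝ (⊤ : ℕ∞) g U) {p : ℝ × ℝ} (hp : p ∈ U) :
    HasFDerivAt (fderiv ℝ g) (fderiv ℝ (fderiv ℝ g) p) p :=
  (((hg.contDiffAt (hU.mem_nhds hp)).fderiv_right (m := 1) (by norm_cast)).differentiableAt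
    (by simp)).hasFDerivAt

theorem ContDiffOn.symm_fderiv_fderiv_of_isOpen {U : Set (ℝ × ℝ)} (hU : IsOpen U) {g : ℝ × ℝ → E3}
    (hg : ContDiffOn ℝ (⊤ : ℕ∞) g U) {p : ℝ × ℝ} (hp : p ∈ U) (v w : ℝ × ℝ) :
    fderiv ℝ (fderiv ℝ g) p v w = fderiv ℝ (fderiv ℝ g) p w v :=
  ((hg.contDiffAt (hU.mem_nhds hp)).isSymmSndFDerivAt (by
    rw [minSmoothness_of_isRCLikeNormedField]
    exact WithTop.coe_le_coe.mpr (le_top : (2 : ℕ∞) ≤ ⊤))) v w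

/-- The derivative of `⟪f, g⟫` in the direction `v`, as a line derivative. -/
theorem hasDerivAt_inner_line {f g : ℝ × ℝ → E3} {f' g' : ℝ × ℝ →L[ℝ] E3} {p : ℝ × ℝ}
    (hf : HasFDerivAt f f' p) (hg : HasFDerivAt g g' p) (v : ℝ × ℝ) :
    HasLineDerivAt ℝ (fun y => ⟪f y, g y⟫_ℝ) (⟪f p, g' v⟫_ℝ + ⟪f' v, g p⟫_ℝ) p v := by
  simpa using (hf.inner ℝ hg).hasLineDerivAt v

theorem lineDeriv_eq_zero_of_eqOn {U : Set (ℝ × ℝ)} (hU : IsOpen U) {F : ℝ × ℝ → ℝ}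
    {p : ℝ × ℝ} (hp : p ∈ U) {c : ℝ} (hF : ∀ y ∈ U, F y = c) {F' : ℝ} {v : ℝ × ℝ}
    (h : HasLineDerivAt ℝ F F' p v) : F' = 0 := by
  have he : F =ᶠ[nhds p] fun _ => c := Filter.eventually_of_mem (hU.mem_nhds hp) hF
  have h₁ := h.congr_of_eventuallyEq he.symm
  have h₂ : HasLineDerivAt ℝ (fun _ : ℝ × ℝ => c) 0 p v := by
    simpa using (hasFDerivAt_const c p).hasLineDerivAt v
  exact h₁.lineDeriv.symm.trans h₂.lineDeriv

theorem HasFDerivAt.eval_const {L : ℝ × ℝ → (ℝ × ℝ →L[ℝ] E3)}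
    {L' : ℝ × ℝ →L[ℝ] ℝ × ℝ →L[ℝ] E3} {p : ℝ × ℝ} (h : HasFDerivAt L L' p) (w : ℝ × ℝ) :
    HasFDerivAt (fun y => L y w) (L'.flip w) p := by
  simpa using h.clm_apply (hasFDerivAt_const w p)

theorem SurfaceData.jet {U : Set (ℝ × ℝ)} {x N : ℝ × ℝ → E3} (hS : SurfaceData U x N)
    {p : ℝ × ℝ} (hp : p ∈ U) :
    SurfaceJet (N p) (fderiv ℝ x p) (fderiv ℝ N p) (fderiv ℝ (fderiv ℝ x) p)
      (fderiv ℝ (fderiv ℝ N) p) := by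
  have hN : ∀ q ∈ U, _ := fun q hq => ContDiffOn.hasFDerivAt_of_isOpen hS.open_U hS.smooth_N hq
  have hx₂ : ∀ q ∈ U, _ := fun q hq => ContDiffOn.hasFDerivAt_fderiv_of_isOpen hS.open_U hS.smooth_x hq
  have hN₂ : ∀ q ∈ U, _ := fun q hq => ContDiffOn.hasFDerivAt_fderiv_of_isOpen hS.open_U hS.smooth_N hq
  have symm_x : ∀ q ∈ U, _ := fun q hq =>
    ContDiffOn.symm_fderiv_fderiv_of_isOpen hS.open_U hS.smooth_x hq
  have weingarten : ∀ q ∈ U, ∀ v w, ⟪fderiv ℝ N q v, fderiv ℝ x q w⟫_ℝ +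
      ⟪N q, fderiv ℝ (fderiv ℝ x) q v w⟫_ℝ = 0 := by
    intro q hq v w
    have := lineDeriv_eq_zero_of_eqOn hS.open_U hq (fun y hy => hS.normal_N y hy w)
      (hasDerivAt_inner_line (hN q hq) ((hx₂ q hq).eval_const w) v)
    simp only [ContinuousLinearMap.flip_apply] at this
    linarith
  refine ⟨hS.immersion p hp, hS.unit_N p hp, hS.normal_N p hp, fun v => ?_, weingarten p hp,
    symm_x p hp, ContDiffOn.symm_fderiv_fderiv_of_isOpen hS.open_U hS.smooth_N hp, fun a b c => ?_⟩
  · have := lineDeriv_eq_zero_of_eqOn hS.open_U hp (c := 1)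
      (fun y hy => by rw [real_inner_self_eq_norm_sq, hS.unit_N y hy]; norm_num)
      (hasDerivAt_inner_line (hN p hp) (hN p hp) v)
    rw [real_inner_comm (N p)] at this
    linarith [real_inner_comm (N p) (fderiv ℝ N p v)]
  · have := lineDeriv_eq_zero_of_eqOn hS.open_U hp (c := 0)
      (F := fun y => ⟪fderiv ℝ N y b, fderiv ℝ x y c⟫_ℝ - ⟪fderiv ℝ N y c, fderiv ℝ x y b⟫_ℝ)
      (fun y hy => by
        have h₁ := weingarten y hy b c
        have h₂ := weingarten y hy c b
        rw [symm_x y hy] at h₂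
        linarith)
      (HasDerivAt.sub
        (hasDerivAt_inner_line ((hN₂ p hp).eval_const b) ((hx₂ p hp).eval_const c) a)
        (hasDerivAt_inner_line ((hN₂ p hp).eval_const c) ((hx₂ p hp).eval_const b) a))
    simp only [ContinuousLinearMap.flip_apply] at this
    linarith

theorem hasFDerivAt_nbi {x N : ℝ × ℝ → E3} {q : W3} {A B : ℝ × ℝ →L[ℝ] E3}
    (hx : HasFDerivAt x A q.1) (hN : HasFDerivAt N B q.1) :
    HasFDerivAt (nbi x N)
      ((A ∘L ContinuousLinearMap.fst ℝ _ _).prod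
        (q.2 • (B ∘L ContinuousLinearMap.fst ℝ _ _) +
          (ContinuousLinearMap.snd ℝ (ℝ × ℝ) ℝ).smulRight (N q.1))) q :=
  (hx.comp q hasFDerivAt_fst).prodMk (hasFDerivAt_snd.smul (hN.comp q hasFDerivAt_fst))

theorem SurfaceData.fderiv_nbi {U : Set (ℝ × ℝ)} {x N : ℝ × ℝ → E3} (hS : SurfaceData U x N)
    {q : W3} (hq : q.1 ∈ U) (v : W3) :
    fderiv ℝ (nbi x N) q v =
      (fderiv ℝ x q.1 v.1, q.2 • fderiv ℝ N q.1 v.1 + v.2 • N q.1) := by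
  rw [(hasFDerivAt_nbi (ContDiffOn.hasFDerivAt_of_isOpen hS.open_U hS.smooth_x hq)
    (ContDiffOn.hasFDerivAt_of_isOpen hS.open_U hS.smooth_N hq)).fderiv]
  simp

theorem SurfaceData.d2_nbi {U : Set (ℝ × ℝ)} {x N : ℝ × ℝ → E3} (hS : SurfaceData U x N)
    {q : W3} (hq : q.1 ∈ U) (v w : W3) :
    d2 (nbi x N) q v w =
      (fderiv ℝ (fderiv ℝ x) q.1 v.1 w.1,
        q.2 • fderiv ℝ (fderiv ℝ N) q.1 v.1 w.1 + v.2 • fderiv ℝ N q.1 w.1 +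
          w.2 • fderiv ℝ N q.1 v.1) := by
  have he : (fun y => fderiv ℝ (nbi x N) y w) =ᶠ[nhds q] fun y =>
      (fderiv ℝ x y.1 w.1, y.2 • fderiv ℝ N y.1 w.1 + w.2 • N y.1) := by
    filter_upwards [(hS.open_U.preimage continuous_fst).mem_nhds hq] with y hy
    exact hS.fderiv_nbi hy w
  have hN := (ContDiffOn.hasFDerivAt_of_isOpen hS.open_U hS.smooth_N hq).comp q hasFDerivAt_fst
  have hx₂ := ((ContDiffOn.hasFDerivAt_fderiv_of_isOpen hS.open_U hS.smooth_x hq).eval_const w.1).comp q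
    hasFDerivAt_fst
  have hN₂ := ((ContDiffOn.hasFDerivAt_fderiv_of_isOpen hS.open_U hS.smooth_N hq).eval_const w.1).comp q
    hasFDerivAt_fst
  have h := hx₂.prodMk ((hasFDerivAt_snd.smul hN₂).add (hN.const_smul w.2))
  have h' := h.congr_of_eventuallyEq he
  rw [d2, h'.fderiv]
  simp

/-- Vanishing trace of the shape operator, expressed without orthonormal frames. -/
theorem SurfMinimalAt.trace_eq_zero {U : Set (ℝ × ℝ)} {x N : ℝ × ℝ → E3}
    (hS : SurfaceData U x N) {p : ℝ × ℝ} (hp : p ∈ U) (hm : SurfMinimalAt x N p) (v w : ℝ × ℝ) :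
    ⟪fderiv ℝ x p w, fderiv ℝ x p w⟫_ℝ * ⟪fderiv ℝ N p v, fderiv ℝ x p v⟫_ℝ
      - 2 * (⟪fderiv ℝ x p v, fderiv ℝ x p w⟫_ℝ * ⟪fderiv ℝ N p v, fderiv ℝ x p w⟫_ℝ)
      + ⟪fderiv ℝ x p v, fderiv ℝ x p v⟫_ℝ * ⟪fderiv ℝ N p w, fderiv ℝ x p w⟫_ℝ = 0 := by
  have hj := hS.jet hp
  obtain ⟨e₁, e₂, h₁₁, h₂₂, h₁₂, hspan⟩ :=
    exists_induced_orthonormal_frame _ hj.inj _ hj.unit hj.normal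
  have htr := hm e₁ e₂ h₁₁ h₂₂ h₁₂
  have h₂₁ := h₁₂
  rw [real_inner_comm] at h₂₁
  have hs := hj.symm e₂ e₁
  obtain ⟨a, b, rfl⟩ : ∃ a b : ℝ, v = a • e₁ + b • e₂ :=
    ⟨_, _, hj.inj (hspan _ (hj.normal v))⟩
  obtain ⟨c, d, rfl⟩ : ∃ a b : ℝ, w = a • e₁ + b • e₂ :=
    ⟨_, _, hj.inj (hspan _ (hj.normal w))⟩
  simp only [map_add, map_smul, inner_add_left, inner_add_right, real_inner_smul_left,
    real_inner_smul_right, h₁₁, h₂₂, h₁₂, h₂₁, hs]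
  linear_combination (a * d - b * c) ^ 2 * htr

/-- The trace of the cubic form of the normal bundle in a fixed direction vanishes
for minimal surfaces. -/
theorem SurfaceData.trace_cubic_eq_zero {U : Set (ℝ × ℝ)} {x N : ℝ × ℝ → E3}
    (hS : SurfaceData U x N) (hm : ∀ p ∈ U, SurfMinimalAt x N p) {p : ℝ × ℝ} (hp : p ∈ U)
    {A B : ℝ × ℝ →L[ℝ] E3} {A₂ B₂ : ℝ × ℝ →L[ℝ] ℝ × ℝ →L[ℝ] E3}
    (hA : A = fderiv ℝ x p) (hB : B = fderiv ℝ N p)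
    (hA₂ : A₂ = fderiv ℝ (fderiv ℝ x) p) (hB₂ : B₂ = fderiv ℝ (fderiv ℝ N) p)
    {e₁ e₂ : ℝ × ℝ} (h₁₁ : ⟪A e₁, A e₁⟫_ℝ = 1) (h₂₂ : ⟪A e₂, A e₂⟫_ℝ = 1)
    (h₁₂ : ⟪A e₁, A e₂⟫_ℝ = 0)
    (hspan : ∀ X : E3, ⟪N p, X⟫_ℝ = 0 → X = A (⟪A e₁, X⟫_ℝ • e₁ + ⟪A e₂, X⟫_ℝ • e₂))
    (w : ℝ × ℝ) :
    ⟪B₂ e₁ e₁, A w⟫_ℝ - ⟪A₂ e₁ e₁, B w⟫_ℝ + (⟪B₂ e₂ e₂, A w⟫_ℝ - ⟪A₂ e₂ e₂, B w⟫_ℝ) = 0 := by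
  have hj := hS.jet hp
  have hx₂ := ContDiffOn.hasFDerivAt_fderiv_of_isOpen hS.open_U hS.smooth_x hp
  have hN₂ := ContDiffOn.hasFDerivAt_fderiv_of_isOpen hS.open_U hS.smooth_N hp
  have hG : ∀ a b : ℝ × ℝ, _ := fun a b =>
    hasDerivAt_inner_line (hx₂.eval_const a) (hx₂.eval_const b) w
  have hM : ∀ a b : ℝ × ℝ, _ := fun a b =>
    hasDerivAt_inner_line (hN₂.eval_const a) (hx₂.eval_const b) w
  have hF := lineDeriv_eq_zero_of_eqOn hS.open_U hp
    (fun y hy => (hm y hy).trace_eq_zero hS hy e₁ e₂)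
    (HasDerivAt.add (HasDerivAt.sub ((hG e₂ e₂).mul (hM e₁ e₁))
      (HasDerivAt.const_mul 2 ((hG e₁ e₂).mul (hM e₁ e₂)))) ((hG e₁ e₁).mul (hM e₂ e₂)))
  simp only [ContinuousLinearMap.flip_apply, zero_smul, add_zero] at hF
  have htr := hm p hp e₁ e₂ (hA ▸ h₁₁) (hA ▸ h₂₂) (hA ▸ h₁₂)
  rw [← hA, ← hB, ← hA₂, ← hB₂] at hj
  rw [← hA, ← hB, ← hA₂, ← hB₂] at hF
  rw [← hA, ← hB] at htr
  have c₁ := hj.codazzi e₁ e₁ w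
  have c₂ := hj.codazzi e₂ e₂ w
  rw [hj.symm_B₂ e₁ w, hj.symm_A₂ e₁ w] at c₁
  rw [hj.symm_B₂ e₂ w, hj.symm_A₂ e₂ w] at c₂
  have b₁ := hspan _ (hj.tangent e₁)
  have b₂ := hspan _ (hj.tangent e₂)
  rw [real_inner_comm (B e₁), real_inner_comm (B e₁)] at b₁
  rw [real_inner_comm (B e₂), real_inner_comm (B e₂), hj.symm e₂ e₁] at b₂
  have k₁ : ∀ X, ⟪B e₁, X⟫_ℝ = ⟪B e₁, A e₁⟫_ℝ * ⟪A e₁, X⟫_ℝ + ⟪B e₁, A e₂⟫_ℝ * ⟪A e₂, X⟫_ℝ := by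
    intro X
    conv_lhs => rw [b₁]
    simp only [map_add, map_smul, inner_add_left, real_inner_smul_left]
  have k₂ : ∀ X, ⟪B e₂, X⟫_ℝ = ⟪B e₁, A e₂⟫_ℝ * ⟪A e₁, X⟫_ℝ + ⟪B e₂, A e₂⟫_ℝ * ⟪A e₂, X⟫_ℝ := by
    intro X
    conv_lhs => rw [b₂]
    simp only [map_add, map_smul, inner_add_left, real_inner_smul_left]
  rw [h₁₁, h₂₂, h₁₂, real_inner_comm (A e₁) (A₂ w e₁), real_inner_comm (A e₂) (A₂ w e₂),
    real_inner_comm (A e₂) (A₂ w e₁)] at hF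
  rw [k₁ (A₂ w e₁)] at c₁ hF
  rw [k₂ (A₂ w e₂)] at c₂ hF
  rw [real_inner_comm (B w) (A₂ e₁ e₁), real_inner_comm (B w) (A₂ e₂ e₂)]
  linear_combination c₁ + c₂ + hF - 2 * (⟪A e₁, A₂ w e₁⟫_ℝ + ⟪A e₂, A₂ w e₂⟫_ℝ) * htr

/-- The tangent space of the normal bundle immersion and its image under the complex structure
span `ℝ⁶`. -/
theorem SurfaceJet.eq_zero_of_orthogonal {n : E3} {A B : ℝ × ℝ →L[ℝ] E3}
    {A₂ B₂ : ℝ × ℝ →L[ℝ] ℝ × ℝ →L[ℝ] E3} (h : SurfaceJet n A B A₂ B₂) (t : ℝ) (H : V6)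
    (hT : ∀ (v : ℝ × ℝ) (s : ℝ), ⟪H.1, A v⟫_ℝ + ⟪H.2, t • B v + s • n⟫_ℝ = 0)
    (hJ : ∀ (v : ℝ × ℝ) (s : ℝ), ⟪H.1, -(t • B v + s • n)⟫_ℝ + ⟪H.2, A v⟫_ℝ = 0) : H = 0 := by
  obtain ⟨X, Y⟩ := H
  obtain ⟨e₁, e₂, -, -, -, hspan⟩ :=
    exists_induced_orthonormal_frame A h.inj n h.unit h.normal
  have hX : ⟪n, X⟫_ℝ = 0 := by
    have := hJ 0 1
    simp at this
    rwa [real_inner_comm]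
  have hY : ⟪n, Y⟫_ℝ = 0 := by
    have := hT 0 1
    simp at this
    rwa [real_inner_comm]
  obtain ⟨a, rfl⟩ : ∃ a, X = A a := ⟨_, hspan X hX⟩
  obtain ⟨b, rfl⟩ : ∃ b, Y = A b := ⟨_, hspan Y hY⟩
  have h₁ := hT a 0
  have h₂ := hJ b 0
  simp only [zero_smul, add_zero, inner_neg_right, real_inner_smul_right] at h₁ h₂
  rw [real_inner_comm (B a), h.symm a b, real_inner_comm (A a) (B b)] at h₁
  have ha : 0 ≤ ⟪A a, A a⟫_ℝ := real_inner_self_nonneg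
  have hb : 0 ≤ ⟪A b, A b⟫_ℝ := real_inner_self_nonneg
  have ha' : A a = 0 := inner_self_eq_zero.mp (by linarith : ⟪A a, A a⟫_ℝ = 0)
  have hb' : A b = 0 := inner_self_eq_zero.mp (by linarith : ⟪A b, A b⟫_ℝ = 0)
  simp [ha', hb']

/-- If the shape operator and the cubic form of a surface are trace-free at a point, then so is
the cubic form of its normal bundle, with respect to any orthonormal frame `(aᵢ, τᵢ)`. -/
theorem SurfaceJet.trace_normal_bundle_cubic_eq_zero {n : E3} {A B : ℝ × ℝ →L[ℝ] E3}
    {A₂ B₂ : ℝ × ℝ →L[ℝ] ℝ × ℝ →L[ℝ] E3} (h : SurfaceJet n A B A₂ B₂)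
    {e₁ e₂ : ℝ × ℝ} (h₁₁ : ⟪A e₁, A e₁⟫_ℝ = 1) (h₂₂ : ⟪A e₂, A e₂⟫_ℝ = 1)
    (h₁₂ : ⟪A e₁, A e₂⟫_ℝ = 0)
    (hspan : ∀ X : E3, ⟪n, X⟫_ℝ = 0 → X = A (⟪A e₁, X⟫_ℝ • e₁ + ⟪A e₂, X⟫_ℝ • e₂))
    (htr : ⟪B e₁, A e₁⟫_ℝ + ⟪B e₂, A e₂⟫_ℝ = 0) {w : ℝ × ℝ}
    (hcub : ⟪B₂ e₁ e₁, A w⟫_ℝ - ⟪A₂ e₁ e₁, B w⟫_ℝ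
      + (⟪B₂ e₂ e₂, A w⟫_ℝ - ⟪A₂ e₂ e₂, B w⟫_ℝ) = 0)
    (t σ : ℝ) {a : Fin 3 → ℝ × ℝ} {τ : Fin 3 → ℝ}
    (ha : ∀ i j, i ≤ j → ⟪A (a i), A (a j)⟫_ℝ + ⟪t • B (a i) + τ i • n, t • B (a j) + τ j • n⟫_ℝ
      = if i = j then 1 else 0) :
    ∑ i, (⟪A₂ (a i) (a i), -(t • B w + σ • n)⟫_ℝ +
      ⟪t • B₂ (a i) (a i) + τ i • B (a i) + τ i • B (a i), A w⟫_ℝ) = 0 := by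
  have h₂₁ := h₁₂
  rw [real_inner_comm] at h₂₁
  set m₁₁ := ⟪B e₁, A e₁⟫_ℝ with hm₁₁
  set m₁₂ := ⟪B e₁, A e₂⟫_ℝ with hm₁₂
  have hm₂₁ : ⟪B e₂, A e₁⟫_ℝ = m₁₂ := h.symm e₂ e₁
  have hm₂₂ : ⟪B e₂, A e₂⟫_ℝ = -m₁₁ := by linarith
  have b₁ : B e₁ = m₁₁ • A e₁ + m₁₂ • A e₂ := by
    have := hspan _ (h.tangent e₁)
    rwa [real_inner_comm (B e₁), real_inner_comm (B e₁), map_add, map_smul, map_smul] at this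
  have b₂ : B e₂ = m₁₂ • A e₁ + (-m₁₁) • A e₂ := by
    have := hspan _ (h.tangent e₂)
    rwa [real_inner_comm (B e₂), real_inner_comm (B e₂), map_add, map_smul, map_smul, hm₂₁,
      hm₂₂] at this
  clear_value m₁₁ m₁₂
  have hnn : ⟪n, n⟫_ℝ = 1 := by rw [real_inner_self_eq_norm_sq, h.unit]; norm_num
  have hAn : ∀ v, ⟪A v, n⟫_ℝ = 0 := fun v => by rw [real_inner_comm]; exact h.normal v
  have hco : ∀ i, ∃ α β : ℝ, a i = α • e₁ + β • e₂ := fun i =>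
    ⟨_, _, h.inj (hspan _ (h.normal (a i)))⟩
  choose α β hαβ using hco
  obtain ⟨r, hr0, hr⟩ : ∃ r : ℝ, r ≠ 0 ∧ r * r = 1 + t ^ 2 * (m₁₁ ^ 2 + m₁₂ ^ 2) :=
    ⟨√(1 + t ^ 2 * (m₁₁ ^ 2 + m₁₂ ^ 2)), by positivity, Real.mul_self_sqrt (by positivity)⟩
  have horth : ∀ i j, i ≤ j →
      (r * α i) * (r * α j) + (r * β i) * (r * β j) + τ i * τ j = if i = j then 1 else 0 := by
    intro i j hij
    rw [← ha i j hij, hαβ i, hαβ j]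
    simp only [map_add, map_smul, b₁, b₂, inner_add_left, inner_add_right, real_inner_smul_left,
      real_inner_smul_right, h₁₁, h₂₂, h₁₂, h₂₁, h.normal, hAn, hnn]
    linear_combination (α i * α j + β i * β j) * hr
  obtain ⟨⟨hαα, hββ⟩, hαβ', hατ, hβτ⟩ := orthonormal_columns_of_rows
    (by simpa using horth 0 0 le_rfl) (by simpa using horth 1 1 le_rfl)
    (by simpa using horth 2 2 le_rfl) (by simpa using horth 0 1 (by decide))
    (by simpa using horth 0 2 (by decide)) (by simpa using horth 1 2 (by decide))
  have hn₁ := h.weingarten e₁ e₁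
  have hn₂ := h.weingarten e₂ e₂
  rw [← hm₁₁, real_inner_comm] at hn₁
  rw [hm₂₂, real_inner_comm] at hn₂
  have hr2 : r * r ≠ 0 := mul_ne_zero hr0 hr0
  apply (mul_eq_zero.mp _).resolve_left hr2
  rw [Fin.sum_univ_three]
  simp only [hαβ, map_add, map_smul, add_apply, smul_apply,
    inner_add_left, inner_add_right, inner_neg_right, real_inner_smul_left,
    real_inner_smul_right, smul_add]
  linear_combination
    (t * ⟪B₂ e₁ e₁, A w⟫_ℝ - t * ⟪A₂ e₁ e₁, B w⟫_ℝ - σ * ⟪A₂ e₁ e₁, n⟫_ℝ) * hαα +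
    (t * ⟪B₂ e₂ e₂, A w⟫_ℝ - t * ⟪A₂ e₂ e₂, B w⟫_ℝ - σ * ⟪A₂ e₂ e₂, n⟫_ℝ) * hββ +
    (t * ⟪B₂ e₁ e₂, A w⟫_ℝ - t * ⟪A₂ e₁ e₂, B w⟫_ℝ - σ * ⟪A₂ e₁ e₂, n⟫_ℝ +
      (t * ⟪B₂ e₂ e₁, A w⟫_ℝ - t * ⟪A₂ e₂ e₁, B w⟫_ℝ - σ * ⟪A₂ e₂ e₁, n⟫_ℝ)) * hαβ' +
    2 * r * ⟪B e₁, A w⟫_ℝ * hατ + 2 * r * ⟪B e₂, A w⟫_ℝ * hβτ + t * hcub - σ * (hn₁ + hn₂)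

/-- The tangent spaces of the normal bundle immersion are isotropic. -/
theorem SurfaceJet.isotropic {n : E3} {A B : ℝ × ℝ →L[ℝ] E3}
    {A₂ B₂ : ℝ × ℝ →L[ℝ] ℝ × ℝ →L[ℝ] E3} (h : SurfaceJet n A B A₂ B₂) (t : ℝ)
    (v w : ℝ × ℝ) (s σ : ℝ) :
    ⟪A v, -(t • B w + σ • n)⟫_ℝ + ⟪t • B v + s • n, A w⟫_ℝ = 0 := by
  have h₁ := h.symm v w
  have h₂ := h.normal v
  rw [real_inner_comm] at h₂
  simp only [inner_add_left, inner_add_right, inner_neg_right, real_inner_smul_left,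
    real_inner_smul_right, h.normal, h₂, real_inner_comm (B w) (A v)]
  linear_combination t * h₁

/-- The second fundamental form of the normal bundle immersion pairs with the image of the tangent
space under the complex structure like the second derivative does. -/
theorem SurfaceData.inner_sff {U : Set (ℝ × ℝ)} {x N : ℝ × ℝ → E3} (hS : SurfaceData U x N)
    {q : W3} (hq : q.1 ∈ U) {v : W3} {m : V6} (hm : IsSFF (nbi x N) q v v m) (w : ℝ × ℝ) (σ : ℝ) :
    ⟪m.1, -(q.2 • fderiv ℝ N q.1 w + σ • N q.1)⟫_ℝ + ⟪m.2, fderiv ℝ x q.1 w⟫_ℝ =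
      ⟪fderiv ℝ (fderiv ℝ x) q.1 v.1 v.1, -(q.2 • fderiv ℝ N q.1 w + σ • N q.1)⟫_ℝ +
      ⟪q.2 • fderiv ℝ (fderiv ℝ N) q.1 v.1 v.1 + v.2 • fderiv ℝ N q.1 v.1 +
          v.2 • fderiv ℝ N q.1 v.1, fderiv ℝ x q.1 w⟫_ℝ := by
  obtain ⟨u, hu⟩ := hm.2
  rw [hS.fderiv_nbi hq, hS.d2_nbi hq] at hu
  have hiso := (hS.jet hq).isotropic q.2 u.1 w u.2 σ
  rw [Prod.ext_iff] at hu
  simp only [Prod.fst_sub, Prod.snd_sub] at hu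
  rw [hu.1, hu.2, inner_sub_left, inner_sub_left] at hiso
  linarith

theorem SurfaceData.meanCurv_eq_zero {U : Set (ℝ × ℝ)} {x N : ℝ × ℝ → E3}
    (hS : SurfaceData U x N) (hm : ∀ p ∈ U, SurfMinimalAt x N p) {q : W3} (hq : q.1 ∈ U) {Hq : V6}
    (hH : IsMeanCurvAt (nbi x N) q Hq) : Hq = 0 := by
  obtain ⟨v₁, v₂, v₃, hON, n₁, n₂, n₃, hn₁, hn₂, hn₃, rfl⟩ := hH
  have hj := hS.jet hq
  obtain ⟨e₁, e₂, h₁₁, h₂₂, h₁₂, hspan⟩ :=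
    exists_induced_orthonormal_frame _ hj.inj _ hj.unit hj.normal
  refine hj.eq_zero_of_orthogonal q.2 _ (fun w σ => ?_) (fun w σ => ?_)
  · have k₁ := hn₁.1 (w, σ)
    have k₂ := hn₂.1 (w, σ)
    have k₃ := hn₃.1 (w, σ)
    rw [hS.fderiv_nbi hq] at k₁ k₂ k₃
    simp only [ip6] at k₁ k₂ k₃
    simp only [Prod.fst_add, Prod.snd_add, inner_add_left]
    linarith
  · have hcub := hS.trace_cubic_eq_zero hm hq rfl rfl rfl rfl h₁₁ h₂₂ h₁₂ hspan w
    have hfr : ∀ i j : Fin 3, i ≤ j →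
        ⟪fderiv ℝ x q.1 (![v₁, v₂, v₃] i).1, fderiv ℝ x q.1 (![v₁, v₂, v₃] j).1⟫_ℝ +
        ⟪q.2 • fderiv ℝ N q.1 (![v₁, v₂, v₃] i).1 + (![v₁, v₂, v₃] i).2 • N q.1,
          q.2 • fderiv ℝ N q.1 (![v₁, v₂, v₃] j).1 + (![v₁, v₂, v₃] j).2 • N q.1⟫_ℝ =
        if i = j then 1 else 0 := by
      simp only [ONFrame, hS.fderiv_nbi hq, ip6] at hON
      obtain ⟨o₁, o₂, o₃, o₄, o₅, o₆⟩ := hON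
      intro i j hij
      fin_cases i <;> fin_cases j <;> first | assumption | exact absurd hij (by decide)
    have key := hj.trace_normal_bundle_cubic_eq_zero h₁₁ h₂₂ h₁₂ hspan
      (hm _ hq e₁ e₂ h₁₁ h₂₂ h₁₂) hcub q.2 σ hfr
    rw [Fin.sum_univ_three] at key
    have k₁ := hS.inner_sff hq hn₁ w σ
    have k₂ := hS.inner_sff hq hn₂ w σ
    have k₃ := hS.inner_sff hq hn₃ w σ
    simp only [Prod.fst_add, Prod.snd_add, inner_add_left n₁.1, inner_add_left n₁.2,
      inner_add_left (n₁.1 + n₂.1), inner_add_left (n₁.2 + n₂.2)]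
    simp only [Matrix.cons_val] at key
    linarith

/-- The second fundamental form along the zero section of the normal bundle. -/
theorem SurfaceData.isSFF_zero_section {U : Set (ℝ × ℝ)} {x N : ℝ × ℝ → E3}
    (hS : SurfaceData U x N) {p : ℝ × ℝ} (hp : p ∈ U) (v : W3) :
    IsSFF (nbi x N) (p, 0) v v
      (⟪N p, fderiv ℝ (fderiv ℝ x) p v.1 v.1⟫_ℝ • N p,
        (2 * v.2) • fderiv ℝ N p v.1) := by
  have hj := hS.jet hp
  obtain ⟨e₁, e₂, -, -, -, hspan⟩ :=
    exists_induced_orthonormal_frame _ hj.inj _ hj.unit hj.normal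
  have hnn : ⟪N p, N p⟫_ℝ = 1 := by rw [real_inner_self_eq_norm_sq, hj.unit]; norm_num
  refine ⟨fun w => ?_, ?_⟩
  · have ht := hj.tangent v.1
    rw [real_inner_comm] at ht
    rw [hS.fderiv_nbi hp]
    simp [ip6, real_inner_smul_left, real_inner_smul_right, hj.normal, ht]
  · obtain ⟨u, hu⟩ : ∃ u, fderiv ℝ (fderiv ℝ x) p v.1 v.1 -
        ⟪N p, fderiv ℝ (fderiv ℝ x) p v.1 v.1⟫_ℝ • N p = fderiv ℝ x p u :=
      ⟨_, hspan _ (by rw [inner_sub_right, real_inner_smul_right, hnn]; ring)⟩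
    refine ⟨(u, 0), ?_⟩
    rw [hS.fderiv_nbi hp, hS.d2_nbi hp, Prod.mk_sub_mk]
    refine Prod.ext hu.symm ?_
    simp only [zero_smul, zero_add, add_zero, ← add_smul, ← two_mul, sub_self]

theorem SurfaceData.surfMinimalAt {U : Set (ℝ × ℝ)} {x N : ℝ × ℝ → E3}
    (hS : SurfaceData U x N) {p : ℝ × ℝ} (hp : p ∈ U)
    (h : ∀ Hq : V6, IsMeanCurvAt (nbi x N) (p, 0) Hq → Hq = 0) : SurfMinimalAt x N p := by
  intro v₁ v₂ h₁₁ h₂₂ h₁₂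
  have hj := hS.jet hp
  have hnn : ⟪N p, N p⟫_ℝ = 1 := by rw [real_inner_self_eq_norm_sq, hj.unit]; norm_num
  have hH := h _ ⟨(v₁, 0), (v₂, 0), (0, 1), by
    refine ⟨?_, ?_, ?_, ?_, ?_, ?_⟩ <;>
      simp only [hS.fderiv_nbi (q := (p, 0)) hp, ip6] <;>
      simp [-inner_self_eq_norm_sq_to_K, h₁₁, h₂₂, h₁₂, hnn], _, _, _,
    hS.isSFF_zero_section hp _, hS.isSFF_zero_section hp _, hS.isSFF_zero_section hp _, rfl⟩
  have h₁ := congrArg (fun z : V6 => ⟪N p, z.1⟫_ℝ) hH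
  simp only [Prod.fst_add, inner_add_right, real_inner_smul_right, hnn, map_zero, inner_zero_right,
    Prod.fst_zero] at h₁
  linarith [hj.weingarten v₁ v₁, hj.weingarten v₂ v₂]

/-- A surface `x` in ℝ³ is minimal if and only if its normal bundle
immersion `f(p,t) = (x p, t • N p)` is a minimal immersion into ℂ³. -/
theorem minimal_iff_normal_bundle_minimal (U : Set (ℝ × ℝ)) (x N : ℝ × ℝ → E3)
    (hS : SurfaceData U x N) :
    (∀ p ∈ U, SurfMinimalAt x N p) ↔
      ∀ q : W3, q.1 ∈ U → ∀ Hq : V6, IsMeanCurvAt (nbi x N) q Hq → Hq = 0 :=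
  ⟨fun hm _ hq _ hH => hS.meanCurv_eq_zero hm hq hH,
    fun h p hp => hS.surfMinimalAt hp (h (p, 0) hp)⟩
end
end

section
/- Let x: U → ℝ³ be a smooth immersed surface with unit normal N and let f(p,t) = (x(p), t·N(p)) be the associated normal bundle immersion of U × ℝ into ℝ⁶ = ℝ³ × ℝ³ with complex structure J(X,Y) = (−Y,X). Then for every q ∈ U × ℝ the differential df_q is injective, and J maps T_q = range(df_q) onto its orthogonal complement in ℝ⁶; that is, f is a Lagrangian immersion of the normal bundle into ℂ³. -/
noncomputable section

open scoped InnerProductSpace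

/-- The differential of `(p, t) ↦ (x p, t • N p)`. -/
theorem fderiv_nbi_apply {x N : ℝ × ℝ → E3} {q : W3} (hx : DifferentiableAt ℝ x q.1)
    (hN : DifferentiableAt ℝ N q.1) (v : W3) :
    fderiv ℝ (nbi x N) q v =
      (fderiv ℝ x q.1 v.1, q.2 • fderiv ℝ N q.1 v.1 + v.2 • N q.1) := by
  have hx' := hx.hasFDerivAt.comp q (hasFDerivAt_fst (𝕜 := ℝ) (p := q))
  have hN' := hN.hasFDerivAt.comp q (hasFDerivAt_fst (𝕜 := ℝ) (p := q))
  have h : HasFDerivAt (nbi x N) _ q :=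
    hx'.prodMk ((hasFDerivAt_snd (𝕜 := ℝ) (p := q)).smul hN')
  rw [h.fderiv]
  simp

namespace SurfaceData

variable {U : Set (ℝ × ℝ)} {x N : ℝ × ℝ → E3} {p : ℝ × ℝ}

theorem contDiffAt_x (hS : SurfaceData U x N) (hp : p ∈ U) : ContDiffAt ℝ (⊤ : ℕ∞) x p :=
  hS.smooth_x.contDiffAt (hS.open_U.mem_nhds hp)

theorem differentiableAt_x (hS : SurfaceData U x N) (hp : p ∈ U) : DifferentiableAt ℝ x p :=
  (hS.contDiffAt_x hp).differentiableAt (by simp)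

theorem differentiableAt_N (hS : SurfaceData U x N) (hp : p ∈ U) : DifferentiableAt ℝ N p :=
  (hS.smooth_N.contDiffAt (hS.open_U.mem_nhds hp)).differentiableAt (by simp)

theorem N_ne_zero (hS : SurfaceData U x N) (hp : p ∈ U) : N p ≠ 0 := by
  rw [← norm_ne_zero_iff, hS.unit_N p hp]
  exact one_ne_zero

/-- Differentiating `⟪N, dx w⟫ = 0` in the direction `v`. -/
theorem inner_fderiv_N_fderiv_x (hS : SurfaceData U x N) (hp : p ∈ U) (v w : ℝ × ℝ) :
    ⟪fderiv ℝ N p v, fderiv ℝ x p w⟫_ℝ = -⟪N p, fderiv ℝ (fderiv ℝ x) p v w⟫_ℝ := by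
  have hd : DifferentiableAt ℝ (fderiv ℝ x) p :=
    ((hS.contDiffAt_x hp).fderiv_right (m := 1) (by norm_cast)).differentiableAt one_ne_zero
  have hdw : HasFDerivAt (fun y => fderiv ℝ x y w) ((fderiv ℝ (fderiv ℝ x) p).flip w) p := by
    simpa using hd.hasFDerivAt.clm_apply (hasFDerivAt_const w p)
  have hzero : (fun y => ⟪N y, fderiv ℝ x y w⟫_ℝ) =ᶠ[nhds p] fun _ => 0 := by
    filter_upwards [hS.open_U.mem_nhds hp] with y hy using hS.normal_N y hy w
  have h := fderiv_inner_apply ℝ (hS.differentiableAt_N hp) hdw.differentiableAt v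
  rw [hzero.fderiv_eq, hdw.fderiv] at h
  simp only [fderiv_fun_const, Pi.zero_apply, zero_apply,
    ContinuousLinearMap.flip_apply] at h
  linarith

/-- The shape operator of a surface is self-adjoint. -/
theorem inner_fderiv_N_fderiv_x_comm (hS : SurfaceData U x N) (hp : p ∈ U) (v w : ℝ × ℝ) :
    ⟪fderiv ℝ N p v, fderiv ℝ x p w⟫_ℝ = ⟪fderiv ℝ N p w, fderiv ℝ x p v⟫_ℝ := by
  have hsymm : IsSymmSndFDerivAt ℝ x p :=
    (hS.contDiffAt_x hp).isSymmSndFDerivAt (by simp; norm_cast)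
  rw [hS.inner_fderiv_N_fderiv_x hp, hS.inner_fderiv_N_fderiv_x hp, hsymm v w]

/-- The tangent plane of a surface is the orthogonal complement of the normal line. -/
theorem range_fderiv_x (hS : SurfaceData U x N) (hp : p ∈ U) :
    LinearMap.range (fderiv ℝ x p : ℝ × ℝ →ₗ[ℝ] E3) = (ℝ ∙ N p)ᗮ := by
  have : Fact (Module.finrank ℝ E3 = 2 + 1) := ⟨by simp⟩
  apply Submodule.eq_of_le_of_finrank_eq
  · rintro _ ⟨v, rfl⟩
    exact Submodule.mem_orthogonal_singleton_iff_inner_right.2 (hS.normal_N p hp v)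
  · rw [Submodule.finrank_orthogonal_span_singleton (n := 2) (hS.N_ne_zero hp),
      LinearMap.finrank_range_of_inj (hS.immersion p hp)]
    simp

end SurfaceData

/-- The normal bundle immersion `f(p,t) = (x p, t • N p)` of a surface in
ℝ³ is a Lagrangian immersion into ℂ³: its differential is injective and `J` maps the
tangent space onto its orthogonal complement. -/
theorem normal_bundle_lagrangian (U : Set (ℝ × ℝ)) (x N : ℝ × ℝ → E3)
    (hS : SurfaceData U x N) :
    ∀ q : W3, q.1 ∈ U → LagrangianAt (nbi x N) q := by
  intro q hq
  have hdf := fderiv_nbi_apply (hS.differentiableAt_x hq) (hS.differentiableAt_N hq)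
  have hrange := hS.range_fderiv_x hq
  refine ⟨?_, Set.Subset.antisymm ?_ ?_⟩
  · rw [injective_iff_map_eq_zero]
    intro v hv
    rw [hdf, Prod.mk_eq_zero] at hv
    have hv₁ : v.1 = 0 := hS.immersion _ hq (by rw [hv.1, map_zero])
    have hv₂ : v.2 = 0 := by simpa [hv₁, hS.N_ne_zero hq] using hv.2
    exact Prod.ext hv₁ hv₂
  · rintro _ ⟨_, ⟨v, rfl⟩, rfl⟩ _ ⟨w, rfl⟩
    have hcomm := hS.inner_fderiv_N_fderiv_x_comm hq v.1 w.1
    have hv := hS.normal_N _ hq v.1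
    have hw := hS.normal_N _ hq w.1
    rw [real_inner_comm] at hv
    rw [real_inner_comm (fderiv ℝ x q.1 v.1)] at hcomm
    simp only [hdf, ip6, Jc, inner_neg_left, inner_add_left, inner_add_right,
      real_inner_smul_left, real_inner_smul_right, hv, hw, hcomm]
    ring
  · intro u hu
    have hu' (w : W3) := hu _ ⟨w, rfl⟩
    simp only [hdf, ip6] at hu'
    obtain ⟨v, hv⟩ : u.2 ∈ LinearMap.range (fderiv ℝ x q.1 : ℝ × ℝ →ₗ[ℝ] E3) := by
      rw [hrange, Submodule.mem_orthogonal_singleton_iff_inner_left]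
      simpa using hu' (0, 1)
    rw [ContinuousLinearMap.coe_coe] at hv
    have hmem : u.1 + q.2 • fderiv ℝ N q.1 v ∈ ℝ ∙ N q.1 := by
      rw [← Submodule.orthogonal_orthogonal (ℝ ∙ N q.1), ← hrange, Submodule.mem_orthogonal']
      rintro _ ⟨w, rfl⟩
      have hw := hu' (w, 0)
      rw [← hv, zero_smul, add_zero, real_inner_smul_right, real_inner_comm,
        real_inner_comm _ (fderiv ℝ x q.1 v), ← hS.inner_fderiv_N_fderiv_x_comm hq v w] at hw
      rw [ContinuousLinearMap.coe_coe, inner_add_left, real_inner_smul_left, real_inner_comm]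
      exact hw
    obtain ⟨c, hc⟩ := Submodule.mem_span_singleton.1 hmem
    refine ⟨_, ⟨(v, -c), rfl⟩, ?_⟩
    rw [hdf]
    refine Prod.ext ?_ hv
    simp only [Jc, neg_smul, hc]
    abel
end
end

section
/- Let x: U → ℝ³ be a smooth immersed surface with unit normal N, {e_1, e_2} a smooth orthonormal tangent frame with A e_1 = a e_1 and A e_2 = b e_2 for the shape operator A, and f(p,t) = (x(p), t·N(p)) the normal bundle immersion with mean curvature vector H. Let ẽ_1 = (1+t²a²)^{−1/2} e_1, ẽ_2 = (1+t²b²)^{−1/2} e_2, ẽ_3 = ∂/∂t (an orthonormal frame for the metric induced by f), and let V = tP e_1 + tQ e_2 + R ∂/∂t be the tangent field on U × ℝ with f_*(V) = JH. Then the directional derivative ∂_V H of the ℝ⁶-valued function H along V satisfies: ⟨∂_V H, f_*(ẽ_1)⟩ = (1+t²a²)^{−1/2}( −t³P² e_1a − 2t³PQ e_2a − t³Q² e_1b − 2tPRa ), ⟨∂_V H, f_*(ẽ_2)⟩ = (1+t²b²)^{−1/2}( −t³P² e_2a − 2t³PQ e_1b − t³Q² e_2b − 2tRQb ), and ⟨∂_V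 H, f_*(ẽ_3)⟩ = −t²P²a − t²Q²b, where P = (1+t²a²)^{−2} e_1a + (1+t²a²)^{−1}(1+t²b²)^{−1} e_1b, Q = (1+t²a²)^{−1}(1+t²b²)^{−1} e_2a + (1+t²b²)^{−2} e_2b, and R = a(1+t²a²)^{−1} + b(1+t²b²)^{−1}. -/
noncomputable section

open scoped InnerProductSpace

lemma ip6_add_left (u v w : V6) : ip6 (u + v) w = ip6 u w + ip6 v w := by
  simp only [ip6, Prod.fst_add, Prod.snd_add, inner_add_left]; ring

lemma ip6_smul_left (c : ℝ) (v w : V6) : ip6 (c • v) w = c * ip6 v w := by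
  simp only [ip6, Prod.smul_fst, Prod.smul_snd, real_inner_smul_left]; ring

lemma ip6_comm (v w : V6) : ip6 v w = ip6 w v := by
  simp only [ip6, real_inner_comm]

lemma ip6_add_right (u v w : V6) : ip6 u (v + w) = ip6 u v + ip6 u w := by
  simp only [ip6_comm u, ip6_add_left]

lemma ip6_smul_right (c : ℝ) (v w : V6) : ip6 v (c • w) = c * ip6 v w := by
  simp only [ip6_comm v, ip6_smul_left]

lemma ip6_neg_left (v w : V6) : ip6 (-v) w = -ip6 v w := by
  simpa using ip6_smul_left (-1) v w

lemma ip6_Jc_left (v w : V6) : ip6 (Jc v) w = -ip6 v (Jc w) := by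
  simp only [ip6, Jc, inner_neg_left, inner_neg_right]; ring

lemma HasFDerivAt.ip6 {F G : W3 → V6} {F' G' : W3 →L[ℝ] V6} {q : W3}
    (hF : HasFDerivAt F F' q) (hG : HasFDerivAt G G' q) (v : W3) :
    fderiv ℝ (fun y => ip6 (F y) (G y)) q v = ip6 (F' v) (G q) + ip6 (F q) (G' v) := by
  have h := (hF.fst.inner ℝ hG.fst).add (hF.snd.inner ℝ hG.snd)
  have h2 := congrArg (· v) h.fderiv
  have e : (fun y => _root_.ip6 (F y) (G y)) =
      (fun y => ⟪(F y).1, (G y).1⟫_ℝ) + fun y => ⟪(F y).2, (G y).2⟫_ℝ := rfl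
  rw [e]
  refine h2.trans ?_
  simp [_root_.ip6]
  ring

lemma HasFDerivAt.Jc {F : W3 → V6} {F' : W3 →L[ℝ] V6} {q : W3} (hF : HasFDerivAt F F' q) :
    HasFDerivAt (fun y => Jc (F y))
      ((-(ContinuousLinearMap.snd ℝ E3 E3 ∘L F')).prod (ContinuousLinearMap.fst ℝ E3 E3 ∘L F')) q :=
  hF.snd.neg.prodMk hF.fst

/-- The trace of a bilinear form over an orthonormal frame, computed in an orthogonal basis. -/
lemma sum_orthonormal_eq {ι W : Type*} [Fintype ι] [DecidableEq ι] [AddCommGroup W] [Module ℝ W]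
    (g B : W →ₗ[ℝ] W →ₗ[ℝ] ℝ) (u v : ι → W) (d : ι → ℝ) (c : ι → ι → ℝ)
    (hd : ∀ i, d i ≠ 0)
    (hg : ∀ i j, g (u i) (u j) = if i = j then d i else 0)
    (hv : ∀ i, v i = ∑ j, c i j • u j)
    (hon : ∀ i j, g (v i) (v j) = if i = j then 1 else 0) :
    ∑ i, B (v i) (v i) = ∑ i, B (u i) (u i) / d i := by
  have key : (Matrix.of c * Matrix.diagonal d) * (Matrix.of c).transpose = 1 := by
    ext i j
    rw [Matrix.one_apply, ← hon i j, hv i, hv j]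
    simp [Matrix.mul_apply, hg, Matrix.diagonal_apply, mul_comm, mul_left_comm]
  rw [mul_eq_one_comm, ← Matrix.mul_assoc] at key
  have hc : ∀ j k, ∑ i, c i j * c i k = if j = k then (d k)⁻¹ else 0 := by
    intro j k
    have h := congrFun (congrFun key j) k
    rw [Matrix.mul_diagonal, Matrix.one_apply, Matrix.mul_apply] at h
    simp only [Matrix.transpose_apply, Matrix.of_apply] at h
    rw [eq_div_of_mul_eq (hd k) h]
    split_ifs <;> simp
  calc ∑ i, B (v i) (v i) = ∑ i, ∑ j, ∑ k, c i j * c i k * B (u j) (u k) := by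
        refine Finset.sum_congr rfl fun i _ => ?_
        rw [hv i]
        simp only [map_sum, map_smul, LinearMap.sum_apply, LinearMap.smul_apply, smul_eq_mul,
          Finset.mul_sum, mul_assoc]
        rw [Finset.sum_comm]
        exact Finset.sum_congr rfl fun j _ => Finset.sum_congr rfl fun k _ => mul_left_comm _ _ _
    _ = ∑ j, ∑ k, (∑ i, c i j * c i k) * B (u j) (u k) := by
        rw [Finset.sum_comm]
        refine Finset.sum_congr rfl fun j _ => ?_
        rw [Finset.sum_comm]
        simp only [Finset.sum_mul]
    _ = ∑ i, B (u i) (u i) / d i := by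
        simp [hc, div_eq_inv_mul]

/-- A surface with an orthonormal tangent frame of principal directions. -/
structure PrincipalFrame (U : Set (ℝ × ℝ)) (x N : ℝ × ℝ → E3) (E₁ E₂ : ℝ × ℝ → ℝ × ℝ)
    (a b : ℝ × ℝ → ℝ) : Prop extends SurfaceData U x N where
  smooth_E₁ : ContDiffOn ℝ (⊤ : ℕ∞) E₁ U
  smooth_E₂ : ContDiffOn ℝ (⊤ : ℕ∞) E₂ U
  orthonormal : ∀ p ∈ U,
      ⟪fderiv ℝ x p (E₁ p), fderiv ℝ x p (E₁ p)⟫_ℝ = 1 ∧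
      ⟪fderiv ℝ x p (E₂ p), fderiv ℝ x p (E₂ p)⟫_ℝ = 1 ∧
      ⟪fderiv ℝ x p (E₁ p), fderiv ℝ x p (E₂ p)⟫_ℝ = 0
  principal₁ : ∀ p ∈ U, fderiv ℝ N p (E₁ p) = (-(a p)) • fderiv ℝ x p (E₁ p)
  principal₂ : ∀ p ∈ U, fderiv ℝ N p (E₂ p) = (-(b p)) • fderiv ℝ x p (E₂ p)

/-- The cubic form `⟨D²f(u, v), J df(w)⟩` of the normal bundle immersion `f`. -/
def cubicForm (x N : ℝ × ℝ → E3) (q u v w : W3) : ℝ :=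
  ip6 (fderiv ℝ (fderiv ℝ (nbi x N)) q u v) (Jc (fderiv ℝ (nbi x N) q w))

namespace PrincipalFrame

variable {U : Set (ℝ × ℝ)} {x N : ℝ × ℝ → E3} {E₁ E₂ : ℝ × ℝ → ℝ × ℝ} {a b : ℝ × ℝ → ℝ}

lemma swap (h : PrincipalFrame U x N E₁ E₂ a b) : PrincipalFrame U x N E₂ E₁ b a where
  toSurfaceData := h.toSurfaceData
  smooth_E₁ := h.smooth_E₂
  smooth_E₂ := h.smooth_E₁
  orthonormal p hp :=
    ⟨(h.orthonormal p hp).2.1, (h.orthonormal p hp).1, by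
      rw [real_inner_comm]; exact (h.orthonormal p hp).2.2⟩
  principal₁ := h.principal₂
  principal₂ := h.principal₁

lemma contDiffAt_x (h : PrincipalFrame U x N E₁ E₂ a b) {p : ℝ × ℝ} (hp : p ∈ U) :
    ContDiffAt ℝ (⊤ : ℕ∞) x p :=
  h.smooth_x.contDiffAt (h.open_U.mem_nhds hp)

lemma contDiffAt_N (h : PrincipalFrame U x N E₁ E₂ a b) {p : ℝ × ℝ} (hp : p ∈ U) :
    ContDiffAt ℝ (⊤ : ℕ∞) N p :=
  h.smooth_N.contDiffAt (h.open_U.mem_nhds hp)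

lemma contDiffAt_E₁ (h : PrincipalFrame U x N E₁ E₂ a b) {p : ℝ × ℝ} (hp : p ∈ U) :
    ContDiffAt ℝ (⊤ : ℕ∞) E₁ p :=
  h.smooth_E₁.contDiffAt (h.open_U.mem_nhds hp)

lemma contDiffAt_dx_E₁ (h : PrincipalFrame U x N E₁ E₂ a b) {p : ℝ × ℝ} (hp : p ∈ U) :
    ContDiffAt ℝ (⊤ : ℕ∞) (fun y => fderiv ℝ x y (E₁ y)) p :=
  ((h.contDiffAt_x hp).fderiv_right (by simp)).clm_apply (h.contDiffAt_E₁ hp)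

lemma contDiffAt_a (h : PrincipalFrame U x N E₁ E₂ a b) {p : ℝ × ℝ} (hp : p ∈ U) :
    ContDiffAt ℝ (⊤ : ℕ∞) a p := by
  have h1 : ContDiffAt ℝ (⊤ : ℕ∞) (fun y => fderiv ℝ N y (E₁ y)) p :=
    ((h.contDiffAt_N hp).fderiv_right (by simp)).clm_apply (h.contDiffAt_E₁ hp)
  refine (h1.inner ℝ (h.contDiffAt_dx_E₁ hp)).neg.congr_of_eventuallyEq ?_
  filter_upwards [h.open_U.mem_nhds hp] with y hy
  rw [h.principal₁ y hy, real_inner_smul_left, (h.orthonormal y hy).1]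
  ring

lemma contDiffAt_nbi (h : PrincipalFrame U x N E₁ E₂ a b) {q : W3} (hq : q.1 ∈ U) :
    ContDiffAt ℝ (⊤ : ℕ∞) (nbi x N) q :=
  ((h.contDiffAt_x hq).comp q contDiffAt_fst).prodMk
    (contDiffAt_snd.smul ((h.contDiffAt_N hq).comp q contDiffAt_fst))

lemma differentiableAt_fderiv_nbi (h : PrincipalFrame U x N E₁ E₂ a b) {q : W3}
    (hq : q.1 ∈ U) : DifferentiableAt ℝ (fderiv ℝ (nbi x N)) q :=
  ((h.contDiffAt_nbi hq).fderiv_right (m := (⊤ : ℕ∞)) (by simp)).differentiableAt (by simp)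

lemma fst_mem_nhds (h : PrincipalFrame U x N E₁ E₂ a b) {q : W3} (hq : q.1 ∈ U) :
    ∀ᶠ y : W3 in nhds q, y.1 ∈ U :=
  continuous_fst.continuousAt.eventually (h.open_U.mem_nhds hq)

lemma fderiv_nbi (h : PrincipalFrame U x N E₁ E₂ a b) {q : W3} (hq : q.1 ∈ U) (v : W3) :
    fderiv ℝ (nbi x N) q v =
      (fderiv ℝ x q.1 v.1, v.2 • N q.1 + q.2 • fderiv ℝ N q.1 v.1) := by
  have hx := ((h.contDiffAt_x hq).differentiableAt (by simp)).hasFDerivAt.comp q hasFDerivAt_fst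
  have hN := ((h.contDiffAt_N hq).differentiableAt (by simp)).hasFDerivAt.comp q hasFDerivAt_fst
  have h2 := hx.prodMk ((hasFDerivAt_snd (𝕜 := ℝ) (p := q)).smul hN)
  refine (congrArg (· v) h2.fderiv).trans ?_
  simp [add_comm]

lemma d2_nbi (h : PrincipalFrame U x N E₁ E₂ a b) {q : W3} (hq : q.1 ∈ U) (v w : W3) :
    d2 (nbi x N) q v w = fderiv ℝ (fderiv ℝ (nbi x N)) q v w := by
  have := (h.differentiableAt_fderiv_nbi hq).hasFDerivAt.clm_apply (hasFDerivAt_const w q)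
  simp [d2, this.fderiv]

lemma exists_coords (h : PrincipalFrame U x N E₁ E₂ a b) {p : ℝ × ℝ} (hp : p ∈ U)
    (v : ℝ × ℝ) : ∃ c₁ c₂ : ℝ, v = c₁ • E₁ p + c₂ • E₂ p := by
  obtain ⟨h1, h2, h3⟩ := h.orthonormal p hp
  have hli : LinearIndependent ℝ ![E₁ p, E₂ p] := by
    rw [LinearIndependent.pair_iff]
    intro s t hst
    have e := congrArg (fderiv ℝ x p) hst
    simp only [map_add, map_smul, map_zero] at e
    have e1 := congrArg (fun z => ⟪z, fderiv ℝ x p (E₁ p)⟫_ℝ) e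
    have e2 := congrArg (fun z => ⟪z, fderiv ℝ x p (E₂ p)⟫_ℝ) e
    simp only [inner_add_left, real_inner_smul_left, h1, h2, h3, inner_zero_left,
      real_inner_comm (fderiv ℝ x p (E₁ p)) (fderiv ℝ x p (E₂ p))] at e1 e2
    constructor <;> linarith
  have hs := hli.span_eq_top_of_card_eq_finrank (by simp)
  have hv : v ∈ Submodule.span ℝ (Set.range ![E₁ p, E₂ p]) := hs ▸ Submodule.mem_top
  rw [Matrix.range_cons, Matrix.range_cons, Matrix.range_empty, Set.union_empty,
    Set.singleton_union, Submodule.mem_span_pair] at hv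
  obtain ⟨s, t, hst⟩ := hv
  exact ⟨s, t, hst.symm⟩

lemma inner_N_self (h : PrincipalFrame U x N E₁ E₂ a b) {p : ℝ × ℝ} (hp : p ∈ U) :
    ⟪N p, N p⟫_ℝ = 1 := by
  rw [real_inner_self_eq_norm_sq, h.unit_N p hp, one_pow]

lemma eq_zero_of_inner (h : PrincipalFrame U x N E₁ E₂ a b) {p : ℝ × ℝ} (hp : p ∈ U) {z : E3}
    (h₁ : ⟪z, fderiv ℝ x p (E₁ p)⟫_ℝ = 0) (h₂ : ⟪z, fderiv ℝ x p (E₂ p)⟫_ℝ = 0)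
    (h₃ : ⟪z, N p⟫_ℝ = 0) : z = 0 := by
  obtain ⟨e1, e2, e3⟩ := h.orthonormal p hp
  have n1 := h.normal_N p hp
  have n2 := h.inner_N_self hp
  have ho : Orthonormal ℝ ![fderiv ℝ x p (E₁ p), fderiv ℝ x p (E₂ p), N p] := by
    rw [orthonormal_iff_ite]
    intro i j
    fin_cases i <;> fin_cases j <;>
      simp [e1, e2, e3, n1, n2, -inner_self_eq_norm_sq_to_K,
        real_inner_comm (N p),
        real_inner_comm (fderiv ℝ x p (E₁ p)) (fderiv ℝ x p (E₂ p))]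
  have hs := ho.linearIndependent.span_eq_top_of_card_eq_finrank (by simp)
  have hz : z ∈ Submodule.span ℝ
      (Set.range ![fderiv ℝ x p (E₁ p), fderiv ℝ x p (E₂ p), N p]) := hs ▸ Submodule.mem_top
  rw [← inner_self_eq_zero (𝕜 := ℝ)]
  have : ∀ y ∈ Submodule.span ℝ
      (Set.range ![fderiv ℝ x p (E₁ p), fderiv ℝ x p (E₂ p), N p]), ⟪z, y⟫_ℝ = 0 := by
    intro y hy
    induction hy using Submodule.span_induction with
    | mem y hy =>
      obtain ⟨i, rfl⟩ := hy
      fin_cases i <;> assumption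
    | zero => simp
    | add y w _ _ hy hw => rw [inner_add_right, hy, hw, add_zero]
    | smul c y _ hy => rw [real_inner_smul_right, hy, mul_zero]
  exact this z hz

lemma inner_dN_symm (h : PrincipalFrame U x N E₁ E₂ a b) {p : ℝ × ℝ} (hp : p ∈ U)
    (v w : ℝ × ℝ) : ⟪fderiv ℝ N p v, fderiv ℝ x p w⟫_ℝ = ⟪fderiv ℝ x p v, fderiv ℝ N p w⟫_ℝ := by
  obtain ⟨c₁, c₂, rfl⟩ := h.exists_coords hp v
  obtain ⟨d₁, d₂, rfl⟩ := h.exists_coords hp w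
  obtain ⟨e1, e2, e3⟩ := h.orthonormal p hp
  simp only [map_add, map_smul, h.principal₁ p hp, h.principal₂ p hp, inner_add_left,
    inner_add_right, real_inner_smul_left, real_inner_smul_right, e1, e2, e3,
    real_inner_comm (fderiv ℝ x p (E₁ p)) (fderiv ℝ x p (E₂ p))]
  ring

lemma lagrangian (h : PrincipalFrame U x N E₁ E₂ a b) {q : W3} (hq : q.1 ∈ U) (v w : W3) :
    ip6 (fderiv ℝ (nbi x N) q v) (Jc (fderiv ℝ (nbi x N) q w)) = 0 := by
  have n1 := h.normal_N q.1 hq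
  simp only [h.fderiv_nbi hq, ip6, Jc, inner_neg_right, inner_add_left, inner_add_right,
    real_inner_smul_left, real_inner_smul_right, h.inner_dN_symm hq, n1,
    real_inner_comm (N q.1)]
  ring

lemma cubicForm_swap (h : PrincipalFrame U x N E₁ E₂ a b) {q : W3} (hq : q.1 ∈ U)
    (u v w : W3) : cubicForm x N q u v w = cubicForm x N q v u w := by
  have := (h.contDiffAt_nbi hq).isSymmSndFDerivAt
    (by simpa using WithTop.coe_le_coe.2 (le_top (a := (2 : ℕ∞))))
  rw [cubicForm, this.eq u v, cubicForm]

lemma cubicForm_swap_right (h : PrincipalFrame U x N E₁ E₂ a b) {q : W3} (hq : q.1 ∈ U)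
    (u v w : W3) : cubicForm x N q u v w = cubicForm x N q u w v := by
  have hd (v : W3) := (h.differentiableAt_fderiv_nbi hq).hasFDerivAt.clm_apply
    (hasFDerivAt_const v q)
  have e := (hd v).ip6 (hd w).Jc u
  have z : (fun y => ip6 (fderiv ℝ (nbi x N) y v) (Jc (fderiv ℝ (nbi x N) y w)))
      =ᶠ[nhds q] fun _ => 0 := by
    filter_upwards [h.fst_mem_nhds hq] with y hy using h.lagrangian hy v w
  rw [z.fderiv_eq] at e
  simp [ip6, cubicForm, Jc, real_inner_comm] at e ⊢
  linarith

lemma cubicForm_E₁_E₁ (h : PrincipalFrame U x N E₁ E₂ a b) {q : W3} (hq : q.1 ∈ U) (v : W3) :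
    cubicForm x N q v (E₁ q.1, 0) (E₁ q.1, 0) =
      -(v.2 * a q.1 + q.2 * fderiv ℝ a q.1 v.1) := by
  have hE : HasFDerivAt (fun y : W3 => ((E₁ y.1, 0) : W3)) _ q :=
    (((h.contDiffAt_E₁ hq).differentiableAt (by simp)).hasFDerivAt.comp q hasFDerivAt_fst).prodMk
      (hasFDerivAt_const (0 : ℝ) q)
  have hF := (h.differentiableAt_fderiv_nbi hq).hasFDerivAt.clm_apply hE
  have hX := ((h.contDiffAt_dx_E₁ hq).differentiableAt (by simp)).hasFDerivAt.comp q
    hasFDerivAt_fst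
  have ha := ((h.contDiffAt_a hq).differentiableAt (by simp)).hasFDerivAt.comp q hasFDerivAt_fst
  have hG := hX.prodMk (((hasFDerivAt_snd (𝕜 := ℝ) (p := q)).mul ha).neg.smul hX)
  have e := (hF.congr_of_eventuallyEq (f₁ := _) ?_).unique hG
  swap
  · filter_upwards [h.fst_mem_nhds hq] with y hy
    simp [h.fderiv_nbi hy, h.principal₁ _ hy, smul_smul]
  have e' := congrArg (fun L => ip6 (L v) (Jc (fderiv ℝ (nbi x N) q (E₁ q.1, 0)))) e
  simp only [add_apply, ip6_add_left] at e'
  simp [h.lagrangian hq] at e'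
  rw [cubicForm, e', h.fderiv_nbi hq]
  simp [ip6, Jc, h.principal₁ _ hq, inner_add_left, real_inner_smul_left, real_inner_smul_right,
    (h.orthonormal _ hq).1, -inner_self_eq_norm_sq_to_K]
  ring

lemma cubicForm_dt (h : PrincipalFrame U x N E₁ E₂ a b) {q : W3} (hq : q.1 ∈ U) (v w : W3) :
    cubicForm x N q v (0, 1) w = ⟪fderiv ℝ N q.1 v.1, fderiv ℝ x q.1 w.1⟫_ℝ := by
  have hF := (h.differentiableAt_fderiv_nbi hq).hasFDerivAt.clm_apply
    (hasFDerivAt_const ((0, 1) : W3) q)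
  have hN := ((h.contDiffAt_N hq).differentiableAt (by simp)).hasFDerivAt.comp q hasFDerivAt_fst
  have hG := (hasFDerivAt_const (0 : E3) q).prodMk hN
  have e := (hF.congr_of_eventuallyEq (f₁ := _) ?_).unique hG
  swap
  · filter_upwards [h.fst_mem_nhds hq] with y hy
    simp [h.fderiv_nbi hy]
  have e' := congrArg (fun L => ip6 (L v) (Jc (fderiv ℝ (nbi x N) q w))) e
  simp at e'
  rw [cubicForm, e', h.fderiv_nbi hq]
  simp [ip6, Jc]

lemma cubicForm_E₁_E₁_left (h : PrincipalFrame U x N E₁ E₂ a b) {q : W3} (hq : q.1 ∈ U) (w : W3) :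
    cubicForm x N q (E₁ q.1, 0) (E₁ q.1, 0) w =
      -(w.2 * a q.1 + q.2 * fderiv ℝ a q.1 w.1) := by
  rw [h.cubicForm_swap_right hq, h.cubicForm_swap hq, h.cubicForm_E₁_E₁ hq]

lemma cubicForm_E₁_dt_E₂ (h : PrincipalFrame U x N E₁ E₂ a b) {q : W3} (hq : q.1 ∈ U) :
    cubicForm x N q (E₁ q.1, 0) (0, 1) (E₂ q.1, 0) = 0 := by
  rw [h.cubicForm_dt hq, h.principal₁ _ hq, real_inner_smul_left, (h.orthonormal _ hq).2.2,
    mul_zero]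

lemma cubicForm_dt_dt (h : PrincipalFrame U x N E₁ E₂ a b) {q : W3} (hq : q.1 ∈ U) (w : W3) :
    cubicForm x N q (0, 1) (0, 1) w = 0 := by
  simp [h.cubicForm_dt hq]

lemma exists_coords_prod (h : PrincipalFrame U x N E₁ E₂ a b) {q : W3} (hq : q.1 ∈ U)
    (v : W3) : ∃ c : Fin 3 → ℝ,
      v = ∑ j, c j • (![(E₁ q.1, 0), (E₂ q.1, 0), (0, 1)] : Fin 3 → W3) j := by
  obtain ⟨c₁, c₂, hc⟩ := h.exists_coords hq v.1
  refine ⟨![c₁, c₂, v.2], ?_⟩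
  rw [Fin.sum_univ_three]
  refine Prod.ext ?_ ?_
  · simpa using hc
  · simp

lemma ip6_meanCurv (h : PrincipalFrame U x N E₁ E₂ a b) {q : W3} (hq : q.1 ∈ U) {Hq : V6}
    (hH : IsMeanCurvAt (nbi x N) q Hq) (w : W3) :
    ip6 Hq (Jc (fderiv ℝ (nbi x N) q w)) =
      cubicForm x N q (E₁ q.1, 0) (E₁ q.1, 0) w / (1 + q.2 ^ 2 * a q.1 ^ 2) +
      cubicForm x N q (E₂ q.1, 0) (E₂ q.1, 0) w / (1 + q.2 ^ 2 * b q.1 ^ 2) := by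
  obtain ⟨v₁, v₂, v₃, ⟨g11, g22, g33, g12, g13, g23⟩, n₁, n₂, n₃, s₁, s₂, s₃, rfl⟩ := hH
  have hn : ∀ v n, IsSFF (nbi x N) q v v n →
      ip6 n (Jc (fderiv ℝ (nbi x N) q w)) = cubicForm x N q v v w := by
    rintro v n ⟨-, z, hz⟩
    rw [cubicForm, ← h.d2_nbi hq, ← sub_add_cancel (d2 (nbi x N) q v v) n, ← hz, ip6_add_left,
      h.lagrangian hq, zero_add]
  rw [ip6_add_left, ip6_add_left, hn _ _ s₁, hn _ _ s₂, hn _ _ s₃]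
  let g : W3 →ₗ[ℝ] W3 →ₗ[ℝ] ℝ := LinearMap.mk₂ ℝ
    (fun u v => ip6 (fderiv ℝ (nbi x N) q u) (fderiv ℝ (nbi x N) q v))
    (fun u v z => by rw [map_add, ip6_add_left])
    (fun c u v => by rw [map_smul, ip6_smul_left]; rfl)
    (fun u v z => by rw [map_add, ip6_add_right])
    (fun c u v => by rw [map_smul, ip6_smul_right]; rfl)
  let B : W3 →ₗ[ℝ] W3 →ₗ[ℝ] ℝ := LinearMap.mk₂ ℝ (fun u v => cubicForm x N q u v w)
    (fun u v z => by simp only [cubicForm, map_add, add_apply, ip6_add_left])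
    (fun c u v => by simp only [cubicForm, map_smul, smul_apply, ip6_smul_left, smul_eq_mul])
    (fun u v z => by simp only [cubicForm, map_add, ip6_add_left])
    (fun c u v => by simp only [cubicForm, map_smul, ip6_smul_left, smul_eq_mul])
  choose c hc using h.exists_coords_prod hq
  obtain ⟨e1, e2, e3⟩ := h.orthonormal q.1 hq
  have n1 := h.normal_N q.1 hq
  have nn := h.inner_N_self hq
  have key := sum_orthonormal_eq g B ![(E₁ q.1, 0), (E₂ q.1, 0), (0, 1)] ![v₁, v₂, v₃]
    ![1 + q.2 ^ 2 * a q.1 ^ 2, 1 + q.2 ^ 2 * b q.1 ^ 2, 1] (fun i => c (![v₁, v₂, v₃] i))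
    (fun i => by fin_cases i <;> simp <;> positivity)
    (fun i j => by
      fin_cases i <;> fin_cases j <;>
      simp [g, h.fderiv_nbi hq, ip6, h.principal₁ _ hq, h.principal₂ _ hq, real_inner_smul_left,
        real_inner_smul_right, e1, e2, e3, n1, nn, -inner_self_eq_norm_sq_to_K,
        real_inner_comm (N q.1),
        real_inner_comm (fderiv ℝ x q.1 (E₁ q.1)) (fderiv ℝ x q.1 (E₂ q.1))] <;> ring)
    (fun i => hc _)
    (fun i j => by
      fin_cases i <;> fin_cases j <;>
      simp [g, g11, g22, g33, g12, g13, g23,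
        ip6_comm (fderiv ℝ (nbi x N) q v₂) (fderiv ℝ (nbi x N) q v₁),
        ip6_comm (fderiv ℝ (nbi x N) q v₃)])
  have hB : ∀ u v, B u v = cubicForm x N q u v w := fun _ _ => rfl
  simp only [hB] at key
  simpa [Fin.sum_univ_three, h.cubicForm_dt_dt hq] using key

end PrincipalFrame

/-- The tangent field `V` with `f₊(V) = JH`, where `H` is the mean curvature vector of the
normal bundle immersion `f`. -/
def maslovField (E₁ E₂ : ℝ × ℝ → ℝ × ℝ) (a b : ℝ × ℝ → ℝ) (q : W3) : W3 :=
  ((q.2 * (fderiv ℝ a q.1 (E₁ q.1) / (1 + q.2 ^ 2 * a q.1 ^ 2) ^ 2 +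
      fderiv ℝ b q.1 (E₁ q.1) / ((1 + q.2 ^ 2 * a q.1 ^ 2) * (1 + q.2 ^ 2 * b q.1 ^ 2)))) • E₁ q.1 +
    (q.2 * (fderiv ℝ a q.1 (E₂ q.1) / ((1 + q.2 ^ 2 * a q.1 ^ 2) * (1 + q.2 ^ 2 * b q.1 ^ 2)) +
      fderiv ℝ b q.1 (E₂ q.1) / (1 + q.2 ^ 2 * b q.1 ^ 2) ^ 2)) • E₂ q.1,
    a q.1 / (1 + q.2 ^ 2 * a q.1 ^ 2) + b q.1 / (1 + q.2 ^ 2 * b q.1 ^ 2))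

namespace PrincipalFrame

variable {U : Set (ℝ × ℝ)} {x N : ℝ × ℝ → E3} {E₁ E₂ : ℝ × ℝ → ℝ × ℝ} {a b : ℝ × ℝ → ℝ}

lemma meanCurv_eq (h : PrincipalFrame U x N E₁ E₂ a b) {q : W3} (hq : q.1 ∈ U) {Hq : V6}
    (hH : IsMeanCurvAt (nbi x N) q Hq) :
    Hq = -Jc (fderiv ℝ (nbi x N) q (maslovField E₁ E₂ a b q)) := by
  have hα : 1 + q.2 ^ 2 * a q.1 ^ 2 ≠ 0 := by positivity
  have hβ : 1 + q.2 ^ 2 * b q.1 ^ 2 ≠ 0 := by positivity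
  obtain ⟨e1, e2, e3⟩ := h.orthonormal q.1 hq
  have n1 := h.normal_N q.1 hq
  have nn := h.inner_N_self hq
  have hN : IsNormalAt (nbi x N) q Hq := by
    obtain ⟨v₁, v₂, v₃, -, n₁, n₂, n₃, s₁, s₂, s₃, rfl⟩ := hH
    intro v
    rw [ip6_add_left, ip6_add_left, s₁.1 v, s₂.1 v, s₃.1 v, add_zero, add_zero]
  have t1 := hN (E₁ q.1, 0)
  have t2 := hN (E₂ q.1, 0)
  have t3 := hN (0, 1)
  have m1 := h.ip6_meanCurv hq hH (E₁ q.1, 0)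
  have m2 := h.ip6_meanCurv hq hH (E₂ q.1, 0)
  have m3 := h.ip6_meanCurv hq hH (0, 1)
  rw [h.cubicForm_E₁_E₁_left hq, h.swap.cubicForm_E₁_E₁_left hq] at m1 m2 m3
  simp only [h.fderiv_nbi hq, ip6, Jc, h.principal₁ _ hq, h.principal₂ _ hq, map_zero, smul_zero,
    zero_smul, one_smul, add_zero, zero_add, inner_zero_right, inner_neg_right,
    real_inner_smul_right] at t1 t2 t3 m1 m2 m3
  have n1' : ∀ v, ⟪fderiv ℝ x q.1 v, N q.1⟫_ℝ = 0 := fun v => by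
    rw [real_inner_comm, n1]
  obtain ⟨P, hP⟩ : ∃ P, P = fderiv ℝ a q.1 (E₁ q.1) / (1 + q.2 ^ 2 * a q.1 ^ 2) ^ 2 +
    fderiv ℝ b q.1 (E₁ q.1) / ((1 + q.2 ^ 2 * a q.1 ^ 2) * (1 + q.2 ^ 2 * b q.1 ^ 2)) := ⟨_, rfl⟩
  obtain ⟨Q, hQ⟩ : ∃ Q, Q =
    fderiv ℝ a q.1 (E₂ q.1) / ((1 + q.2 ^ 2 * a q.1 ^ 2) * (1 + q.2 ^ 2 * b q.1 ^ 2)) +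
      fderiv ℝ b q.1 (E₂ q.1) / (1 + q.2 ^ 2 * b q.1 ^ 2) ^ 2 := ⟨_, rfl⟩
  have k21 : ⟪Hq.2, fderiv ℝ x q.1 (E₁ q.1)⟫_ℝ = -(q.2 * P) := by
    have e : -(q.2 * P) * (1 + q.2 ^ 2 * a q.1 ^ 2) =
        -(q.2 * fderiv ℝ a q.1 (E₁ q.1)) / (1 + q.2 ^ 2 * a q.1 ^ 2) +
        -(q.2 * fderiv ℝ b q.1 (E₁ q.1)) / (1 + q.2 ^ 2 * b q.1 ^ 2) := by
      rw [hP]; field_simp; ring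
    refine mul_right_cancel₀ hα ?_
    rw [e]
    linear_combination m1 - q.2 * a q.1 * t1
  have k22 : ⟪Hq.2, fderiv ℝ x q.1 (E₂ q.1)⟫_ℝ = -(q.2 * Q) := by
    have e : -(q.2 * Q) * (1 + q.2 ^ 2 * b q.1 ^ 2) =
        -(q.2 * fderiv ℝ a q.1 (E₂ q.1)) / (1 + q.2 ^ 2 * a q.1 ^ 2) +
        -(q.2 * fderiv ℝ b q.1 (E₂ q.1)) / (1 + q.2 ^ 2 * b q.1 ^ 2) := by
      rw [hQ]; field_simp; ring
    refine mul_right_cancel₀ hβ ?_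
    rw [e]
    linear_combination m2 - q.2 * b q.1 * t2
  rw [maslovField, ← hP, ← hQ, h.fderiv_nbi hq]
  simp only [Jc, map_add, map_smul, h.principal₁ _ hq, h.principal₂ _ hq]
  refine Prod.ext (sub_eq_zero.1 (h.eq_zero_of_inner hq ?_ ?_ ?_))
    (sub_eq_zero.1 (h.eq_zero_of_inner hq ?_ ?_ ?_)) <;>
  simp only [Prod.fst_neg, Prod.snd_neg, neg_neg, inner_sub_left, inner_add_left, inner_neg_left,
    real_inner_smul_left, e1, e2, e3, n1, n1', nn,
    real_inner_comm (fderiv ℝ x q.1 (E₁ q.1)) (fderiv ℝ x q.1 (E₂ q.1))]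
  · linear_combination t1 + q.2 * a q.1 * k21
  · linear_combination t2 + q.2 * b q.1 * k22
  · linear_combination -m3
  · linear_combination k21
  · linear_combination k22
  · linear_combination t3

lemma differentiableAt_maslovField (h : PrincipalFrame U x N E₁ E₂ a b) {q : W3}
    (hq : q.1 ∈ U) : DifferentiableAt ℝ (maslovField E₁ E₂ a b) q := by
  have hd {φ : ℝ × ℝ → ℝ} (hφ : ContDiffAt ℝ (⊤ : ℕ∞) φ q.1) :
      DifferentiableAt ℝ (fderiv ℝ φ) q.1 :=
    (hφ.fderiv_right (m := (⊤ : ℕ∞)) (by simp)).differentiableAt (by simp)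
  have ha := (h.contDiffAt_a hq).differentiableAt (by simp)
  have hb := (h.swap.contDiffAt_a hq).differentiableAt (by simp)
  have hE₁ := (h.contDiffAt_E₁ hq).differentiableAt (by simp)
  have hE₂ := (h.swap.contDiffAt_E₁ hq).differentiableAt (by simp)
  have hda := hd (h.contDiffAt_a hq)
  have hdb := hd (h.swap.contDiffAt_a hq)
  clear hd
  unfold maslovField
  fun_prop (disch := positivity)

lemma ip6_fderiv_meanCurv (h : PrincipalFrame U x N E₁ E₂ a b) {H : W3 → V6}
    (hH : ∀ q : W3, q.1 ∈ U → IsMeanCurvAt (nbi x N) q (H q)) {q : W3} (hq : q.1 ∈ U)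
    (v w : W3) :
    ip6 (fderiv ℝ H q v) (fderiv ℝ (nbi x N) q w) =
      cubicForm x N q v (maslovField E₁ E₂ a b q) w := by
  have hG := ((h.differentiableAt_fderiv_nbi hq).hasFDerivAt.clm_apply
    (h.differentiableAt_maslovField hq).hasFDerivAt).Jc.neg
  have hHd : DifferentiableAt ℝ H q := by
    refine (hG.congr_of_eventuallyEq ?_).differentiableAt
    filter_upwards [h.fst_mem_nhds hq] with y hy using h.meanCurv_eq hy (hH y hy)
  have e := hHd.hasFDerivAt.ip6 ((h.differentiableAt_fderiv_nbi hq).hasFDerivAt.clm_apply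
    (hasFDerivAt_const w q)) v
  have z : (fun y => ip6 (H y) (fderiv ℝ (nbi x N) y w)) =ᶠ[nhds q] fun _ => 0 := by
    filter_upwards [h.fst_mem_nhds hq] with y hy
    rw [h.meanCurv_eq hy (hH y hy), ip6_neg_left, ip6_Jc_left, h.lagrangian hy, neg_zero, neg_zero]
  rw [z.fderiv_eq, h.meanCurv_eq hq (hH q hq), ip6_neg_left, ip6_comm (Jc _)] at e
  rw [h.cubicForm_swap_right hq, cubicForm]
  simp at e
  linarith

/-- The cubic form on `V, V, ·`, for `V = k e₁ + l e₂ + r ∂/∂t`. -/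
lemma cubicForm_expand (h : PrincipalFrame U x N E₁ E₂ a b) {q : W3} (hq : q.1 ∈ U)
    (k l r : ℝ) (w : W3) :
    cubicForm x N q (k • E₁ q.1 + l • E₂ q.1, r) (k • E₁ q.1 + l • E₂ q.1, r) w =
      k ^ 2 * cubicForm x N q (E₁ q.1, 0) (E₁ q.1, 0) w +
      2 * k * l * cubicForm x N q (E₁ q.1, 0) (E₂ q.1, 0) w +
      l ^ 2 * cubicForm x N q (E₂ q.1, 0) (E₂ q.1, 0) w +
      2 * k * r * cubicForm x N q (E₁ q.1, 0) (0, 1) w +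
      2 * l * r * cubicForm x N q (E₂ q.1, 0) (0, 1) w := by
  have hV : ((k • E₁ q.1 + l • E₂ q.1, r) : W3) =
      k • (E₁ q.1, 0) + l • (E₂ q.1, 0) + r • (0, 1) := by simp
  have s1 := h.cubicForm_swap hq (E₂ q.1, 0) (E₁ q.1, 0) w
  have s2 := h.cubicForm_swap hq (0, 1) (E₁ q.1, 0) w
  have s3 := h.cubicForm_swap hq (0, 1) (E₂ q.1, 0) w
  have s4 := h.cubicForm_dt_dt hq w
  rw [hV]
  simp only [cubicForm, map_add, map_smul, add_apply, smul_apply, ip6_add_left,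
    ip6_smul_left] at s1 s2 s3 s4 ⊢
  rw [s1, s2, s3, s4]
  ring

end PrincipalFrame

/-- The components of the directional derivative `∂_V H` of the mean
curvature vector `H` of the normal bundle immersion along the tangent direction `V` with
`f₊(V) = JH`, in the induced orthonormal frame `ẽ₁, ẽ₂, ẽ₃`. -/
theorem normal_bundle_JH_derivative (U : Set (ℝ × ℝ)) (x N : ℝ × ℝ → E3)
    (hS : SurfaceData U x N) (E₁ E₂ : ℝ × ℝ → ℝ × ℝ) (a b : ℝ × ℝ → ℝ)
    (hE₁ : ContDiffOn ℝ (⊤ : ℕ∞) E₁ U) (hE₂ : ContDiffOn ℝ (⊤ : ℕ∞) E₂ U)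
    (hon : ∀ p ∈ U,
      ⟪fderiv ℝ x p (E₁ p), fderiv ℝ x p (E₁ p)⟫_ℝ = 1 ∧
      ⟪fderiv ℝ x p (E₂ p), fderiv ℝ x p (E₂ p)⟫_ℝ = 1 ∧
      ⟪fderiv ℝ x p (E₁ p), fderiv ℝ x p (E₂ p)⟫_ℝ = 0)
    (heig₁ : ∀ p ∈ U, fderiv ℝ N p (E₁ p) = (-(a p)) • fderiv ℝ x p (E₁ p))
    (heig₂ : ∀ p ∈ U, fderiv ℝ N p (E₂ p) = (-(b p)) • fderiv ℝ x p (E₂ p))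
    (H : W3 → V6) (hH : ∀ q : W3, q.1 ∈ U → IsMeanCurvAt (nbi x N) q (H q)) :
    ∀ p ∈ U, ∀ t : ℝ, ∀ P Q R : ℝ,
      P = fderiv ℝ a p (E₁ p) / (1 + t ^ 2 * a p ^ 2) ^ 2 +
          fderiv ℝ b p (E₁ p) / ((1 + t ^ 2 * a p ^ 2) * (1 + t ^ 2 * b p ^ 2)) →
      Q = fderiv ℝ a p (E₂ p) / ((1 + t ^ 2 * a p ^ 2) * (1 + t ^ 2 * b p ^ 2)) +
          fderiv ℝ b p (E₂ p) / (1 + t ^ 2 * b p ^ 2) ^ 2 →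
      R = a p / (1 + t ^ 2 * a p ^ 2) + b p / (1 + t ^ 2 * b p ^ 2) →
      ∀ V : W3, V = ((t * P) • E₁ p + (t * Q) • E₂ p, R) →
        ip6 (fderiv ℝ H (p, t) V)
            (fderiv ℝ (nbi x N) (p, t)
              ((Real.sqrt (1 + t ^ 2 * a p ^ 2))⁻¹ • E₁ p, (0 : ℝ))) =
          (Real.sqrt (1 + t ^ 2 * a p ^ 2))⁻¹ *
            (-(t ^ 3 * P ^ 2 * fderiv ℝ a p (E₁ p)) -
              2 * t ^ 3 * P * Q * fderiv ℝ a p (E₂ p) -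
              t ^ 3 * Q ^ 2 * fderiv ℝ b p (E₁ p) - 2 * t * P * R * a p) ∧
        ip6 (fderiv ℝ H (p, t) V)
            (fderiv ℝ (nbi x N) (p, t)
              ((Real.sqrt (1 + t ^ 2 * b p ^ 2))⁻¹ • E₂ p, (0 : ℝ))) =
          (Real.sqrt (1 + t ^ 2 * b p ^ 2))⁻¹ *
            (-(t ^ 3 * P ^ 2 * fderiv ℝ a p (E₂ p)) -
              2 * t ^ 3 * P * Q * fderiv ℝ b p (E₁ p) -
              t ^ 3 * Q ^ 2 * fderiv ℝ b p (E₂ p) - 2 * t * R * Q * b p) ∧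
        ip6 (fderiv ℝ H (p, t) V)
            (fderiv ℝ (nbi x N) (p, t) ((0 : ℝ × ℝ), (1 : ℝ))) =
          -(t ^ 2 * P ^ 2 * a p) - t ^ 2 * Q ^ 2 * b p := by
  have h : PrincipalFrame U x N E₁ E₂ a b := ⟨hS, hE₁, hE₂, hon, heig₁, heig₂⟩
  rintro p hp t P Q R hP hQ hR V hV
  have hq : ((p, t) : W3).1 ∈ U := hp
  have hVm : maslovField E₁ E₂ a b (p, t) = V := by rw [hV, hP, hQ, hR]; rfl
  have hsmul : ∀ (c : ℝ) (v : ℝ × ℝ), ((c • v, (0 : ℝ)) : W3) = c • (v, 0) := by simp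
  have T : ∀ w, ip6 (fderiv ℝ H (p, t) V) (fderiv ℝ (nbi x N) (p, t) w) =
      (t * P) ^ 2 * cubicForm x N (p, t) (E₁ p, 0) (E₁ p, 0) w +
      2 * (t * P) * (t * Q) * cubicForm x N (p, t) (E₁ p, 0) (E₂ p, 0) w +
      (t * Q) ^ 2 * cubicForm x N (p, t) (E₂ p, 0) (E₂ p, 0) w +
      2 * (t * P) * R * cubicForm x N (p, t) (E₁ p, 0) (0, 1) w +
      2 * (t * Q) * R * cubicForm x N (p, t) (E₂ p, 0) (0, 1) w := by
    intro w
    rw [h.ip6_fderiv_meanCurv hH hq, hVm, hV]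
    exact h.cubicForm_expand hq _ _ _ w
  have c11 := h.cubicForm_E₁_E₁_left hq
  have c22 := h.swap.cubicForm_E₁_E₁_left hq
  have c12 : cubicForm x N (p, t) (E₁ p, 0) (E₂ p, 0) (0, 1) = 0 := by
    rw [h.cubicForm_swap_right hq]; exact h.cubicForm_E₁_dt_E₂ hq
  have c121 := h.cubicForm_swap_right hq (E₁ p, 0) (E₂ p, 0) (E₁ p, 0)
  have c122 := h.cubicForm_swap hq (E₁ p, 0) (E₂ p, 0) (E₂ p, 0)
  have c122' := h.cubicForm_swap_right hq (E₂ p, 0) (E₁ p, 0) (E₂ p, 0)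
  have d11 := h.cubicForm_swap_right hq (E₁ p, 0) (0, 1) (E₁ p, 0)
  have d22 := h.cubicForm_swap_right hq (E₂ p, 0) (0, 1) (E₂ p, 0)
  have d12 := h.cubicForm_E₁_dt_E₂ hq
  have d21 := h.swap.cubicForm_E₁_dt_E₂ hq
  have d1 := h.cubicForm_dt hq (E₁ p, 0) (0, 1)
  have d2 := h.cubicForm_dt hq (E₂ p, 0) (0, 1)
  simp only [map_zero, inner_zero_right] at c11 c22 d12 d21 d1 d2
  rw [hsmul, hsmul, map_smul, map_smul, ip6_smul_right, ip6_smul_right, T, T, T, c121, c122, c122',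
    d11, d22, d12, d21, d1, d2, c12]
  simp only [c11, c22, map_zero]
  refine ⟨?_, ?_, ?_⟩ <;> ring
end
end

section
/- Let x: U → ℝ³ be a smooth immersed surface with unit normal N, and suppose there is a smooth orthonormal tangent frame {e_1, e_2} with A e_1 = 0 and A e_2 = b e_2 for the shape operator A, where the function b is nowhere zero, its directional derivative e_2b vanishes identically, and its directional derivative e_1b is nowhere zero. Then every point of U has an open neighborhood V and a rigid motion Φ of ℝ³ such that Φ(x(V)) is contained in the circular cone C_r = {(s·r·cos θ, s·r·sin θ, s)/√(r²+1) : s > 0, θ ∈ ℝ} for some r ≠ 0. -/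
noncomputable section

open scoped InnerProductSpace

/-- Every unit vector is carried to the third coordinate direction by some rotation. -/
theorem exists_rotation_third_coord (w : E3) (hw : ‖w‖ = 1) :
    ∃ S : E3 ≃ₗᵢ[ℝ] E3, LinearMap.det (S.toLinearEquiv : E3 →ₗ[ℝ] E3) = 1 ∧
      ∀ y, (S y) 2 = ⟪w, y⟫_ℝ := by
  have hv : Orthonormal ℝ (({2} : Set (Fin 3)).domRestrict (fun _ => w)) := by
    refine ⟨fun _ => hw, fun i j hij => ?_⟩
    exact absurd (Subsingleton.elim i j) hij
  obtain ⟨B, hB⟩ := hv.exists_orthonormalBasis_extension_of_card_eq (by simp)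
  have hB2 : B 2 = w := hB 2 rfl
  have hrepr : ∀ y, (B.repr y) 2 = ⟪w, y⟫_ℝ := fun y => by
    rw [B.repr_apply_apply, hB2]
  have habs : |LinearMap.det (B.repr.toLinearEquiv : E3 →ₗ[ℝ] E3)| = 1 := by
    rw [← LinearMap.normDet_eq_abs_det]
    exact LinearIsometry.normDet_eq_one B.repr.toLinearIsometry
  rcases eq_or_eq_neg_of_abs_eq habs with h | h
  · exact ⟨B.repr, h, hrepr⟩
  · let e : E3 := EuclideanSpace.single 0 1
    let K : Submodule ℝ E3 := (ℝ ∙ e)ᗮ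
    refine ⟨B.repr.trans K.reflection, ?_, fun y => ?_⟩
    · have hfin : Module.finrank ℝ Kᗮ = 1 := by
        rw [show Kᗮ = ℝ ∙ e from Submodule.orthogonal_orthogonal _]
        exact finrank_span_singleton (by simp [e])
      have hK := K.det_reflection
      rw [hfin, pow_one] at hK
      have hcomp : ((B.repr.trans K.reflection).toLinearEquiv : E3 →ₗ[ℝ] E3) =
          K.reflection.toLinearMap ∘ₗ (B.repr.toLinearEquiv : E3 →ₗ[ℝ] E3) := rfl
      rw [hcomp, LinearMap.det_comp, h, hK]
      norm_num
    · have hmem : (EuclideanSpace.single 2 1 : E3) ∈ K := by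
        refine Submodule.mem_orthogonal_singleton_iff_inner_right.2 ?_
        rw [EuclideanSpace.inner_single_left]
        simp
      have hfix : K.reflection (EuclideanSpace.single 2 1) = EuclideanSpace.single 2 1 :=
        (K.reflection_eq_self_iff _).2 hmem
      have hin := K.reflection.inner_map_map (EuclideanSpace.single 2 1) (B.repr y)
      rw [hfix] at hin
      simp only [EuclideanSpace.inner_single_left, map_one, one_mul, hrepr] at hin
      exact hin

theorem mem_coneSet_of_norm_eq {r s : ℝ} (hr : 0 < r) (hs : 0 < s) {y : E3} (hy : ‖y‖ = s)
    (hy₂ : y 2 = s / Real.sqrt (r ^ 2 + 1)) : y ∈ coneSet r := by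
  have hpos : 0 < r ^ 2 + 1 := by positivity
  have hq : 0 < Real.sqrt (r ^ 2 + 1) := Real.sqrt_pos.2 hpos
  have hsq := Real.sq_sqrt hpos.le
  have hn : y 0 ^ 2 + y 1 ^ 2 + y 2 ^ 2 = s ^ 2 := by
    rw [← hy, EuclideanSpace.real_norm_sq_eq, Fin.sum_univ_three]
  let z : ℂ := ⟨y 0, y 1⟩
  have hz : ‖z‖ = s * r / Real.sqrt (r ^ 2 + 1) := by
    rw [← sq_eq_sq₀ (norm_nonneg z) (by positivity), Complex.sq_norm, Complex.normSq_apply]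
    rw [hy₂] at hn
    simp only [div_pow, mul_pow, hsq] at hn ⊢
    field_simp at hn ⊢
    simp only [z]
    linarith
  refine ⟨s, z.arg, hs, ?_, ?_, hy₂⟩
  · have hre : ‖z‖ * Real.cos z.arg = y 0 := Complex.norm_mul_cos_arg z
    rw [← hre, hz]
    ring
  · have him : ‖z‖ * Real.sin z.arg = y 1 := Complex.norm_mul_sin_arg z
    rw [← him, hz]
    ring

theorem ContDiffOn.fderiv_apply_field {F : Type*} [NormedAddCommGroup F] [NormedSpace ℝ F]
    {U : Set (ℝ × ℝ)} (hU : IsOpen U) {f : ℝ × ℝ → F} {E : ℝ × ℝ → ℝ × ℝ}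
    (hf : ContDiffOn ℝ (⊤ : ℕ∞) f U) (hE : ContDiffOn ℝ (⊤ : ℕ∞) E U) :
    ContDiffOn ℝ (⊤ : ℕ∞) (fun q => fderiv ℝ f q (E q)) U :=
  (hf.fderiv_of_isOpen hU (by exact_mod_cast le_top)).clm_apply hE

theorem Set.EqOn.fderiv_eq_of_isOpen {F : Type*} [NormedAddCommGroup F] [NormedSpace ℝ F]
    {U : Set (ℝ × ℝ)} (hU : IsOpen U) {f g : ℝ × ℝ → F} (h : Set.EqOn f g U)
    {p : ℝ × ℝ} (hp : p ∈ U) : fderiv ℝ f p = fderiv ℝ g p :=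
  (h.eventuallyEq_of_mem (hU.mem_nhds hp)).fderiv_eq

theorem fderiv_lieBracket_of_contDiffOn {F : Type*} [NormedAddCommGroup F] [NormedSpace ℝ F]
    {U : Set (ℝ × ℝ)} (hU : IsOpen U) {f : ℝ × ℝ → F} {E₁ E₂ : ℝ × ℝ → ℝ × ℝ}
    (hf : ContDiffOn ℝ (⊤ : ℕ∞) f U) (hE₁ : ContDiffOn ℝ (⊤ : ℕ∞) E₁ U)
    (hE₂ : ContDiffOn ℝ (⊤ : ℕ∞) E₂ U) {p : ℝ × ℝ} (hp : p ∈ U) :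
    fderiv ℝ f p (VectorField.lieBracket ℝ E₁ E₂ p) =
      fderiv ℝ (fun q => fderiv ℝ f q (E₂ q)) p (E₁ p) -
        fderiv ℝ (fun q => fderiv ℝ f q (E₁ q)) p (E₂ p) := by
  have hn := hU.mem_nhds hp
  exact VectorField.fderiv_apply_lieBracket (hf.contDiffAt hn)
    (by simpa using WithTop.coe_le_coe.2 (le_top : (2 : ℕ∞) ≤ ⊤))
    ((hE₂.contDiffAt hn).differentiableAt (by simp))
    ((hE₁.contDiffAt hn).differentiableAt (by simp))

/-- A smooth map of constant length one is orthogonal to its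
derivatives. -/
theorem inner_fderiv_eq_zero_of_inner_self_eq_one {U : Set (ℝ × ℝ)} (hU : IsOpen U)
    {f : ℝ × ℝ → E3} (hf : ContDiffOn ℝ (⊤ : ℕ∞) f U) (h : ∀ q ∈ U, ⟪f q, f q⟫_ℝ = 1)
    {p : ℝ × ℝ} (hp : p ∈ U) (v : ℝ × ℝ) : ⟪fderiv ℝ f p v, f p⟫_ℝ = 0 := by
  have hd := (hf.contDiffAt (hU.mem_nhds hp)).differentiableAt (by simp)
  have h0 := Set.EqOn.fderiv_eq_of_isOpen hU (g := fun _ => (1 : ℝ)) h hp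
  have h1 := congrArg (fun L => L v) h0
  simp only [fderiv_inner_apply ℝ hd hd, fderiv_fun_const, real_inner_comm (fderiv ℝ f p v)] at h1
  rw [real_inner_comm] at h1 ⊢
  simpa using h1

theorem inner_fderiv_eq_neg_of_inner_eq_zero {U : Set (ℝ × ℝ)} (hU : IsOpen U)
    {f g : ℝ × ℝ → E3} (hf : ContDiffOn ℝ (⊤ : ℕ∞) f U) (hg : ContDiffOn ℝ (⊤ : ℕ∞) g U)
    (h : ∀ q ∈ U, ⟪f q, g q⟫_ℝ = 0) {p : ℝ × ℝ} (hp : p ∈ U) (v : ℝ × ℝ) :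
    ⟪fderiv ℝ f p v, g p⟫_ℝ = -⟪f p, fderiv ℝ g p v⟫_ℝ := by
  have hdf := (hf.contDiffAt (hU.mem_nhds hp)).differentiableAt (by simp)
  have hdg := (hg.contDiffAt (hU.mem_nhds hp)).differentiableAt (by simp)
  have h0 := Set.EqOn.fderiv_eq_of_isOpen hU (g := fun _ => (0 : ℝ)) h hp
  have h1 := congrArg (fun L => L v) h0
  simp only [fderiv_inner_apply ℝ hdf hdg, fderiv_fun_const] at h1
  simp at h1
  linarith

theorem eq_zero_of_inner_orthonormal_eq_zero {a b c v : E3} (h : Orthonormal ℝ ![a, b, c])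
    (ha : ⟪v, a⟫_ℝ = 0) (hb : ⟪v, b⟫_ℝ = 0) (hc : ⟪v, c⟫_ℝ = 0) : v = 0 := by
  have hspan := h.linearIndependent.span_eq_top_of_card_eq_finrank (by simp)
  have hv : v ∈ (Submodule.span ℝ (Set.range ![a, b, c]))ᗮ := by
    rw [Submodule.mem_orthogonal']
    intro u hu
    induction hu using Submodule.span_induction with
    | mem u hu =>
      obtain ⟨i, rfl⟩ := hu
      fin_cases i <;> simp [ha, hb, hc]
    | zero => simp
    | add u w _ _ hu hw => simp [inner_add_right, hu, hw]
    | smul t u _ hu => simp [inner_smul_right, hu]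
  rw [hspan] at hv
  simpa using hv

theorem norm_eq_one_of_real_inner_self {v : E3} (h : ⟪v, v⟫_ℝ = 1) : ‖v‖ = 1 := by
  rw [norm_eq_sqrt_real_inner, h, Real.sqrt_one]

theorem exists_smul_add_smul_of_orthonormal_image {F : Type*} [NormedAddCommGroup F]
    [InnerProductSpace ℝ F] (T : (ℝ × ℝ) →L[ℝ] F) {u₁ u₂ : ℝ × ℝ} (h₁ : ⟪T u₁, T u₁⟫_ℝ = 1)
    (h₂ : ⟪T u₂, T u₂⟫_ℝ = 1) (h₁₂ : ⟪T u₁, T u₂⟫_ℝ = 0) (v : ℝ × ℝ) :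
    ∃ s t : ℝ, v = s • u₁ + t • u₂ := by
  have hli : LinearIndependent ℝ ![u₁, u₂] := by
    rw [LinearIndependent.pair_iff]
    intro s t hst
    have h := congrArg T hst
    simp only [map_add, map_smul, map_zero] at h
    have ha := congrArg (fun y => ⟪T u₁, y⟫_ℝ) h
    have hb := congrArg (fun y => ⟪T u₂, y⟫_ℝ) h
    simp only [inner_add_right, inner_smul_right, inner_zero_right, h₁, h₁₂] at ha
    simp only [inner_add_right, inner_smul_right, inner_zero_right, h₂,
      real_inner_comm (T u₁) (T u₂) ▸ h₁₂] at hb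
    exact ⟨by simpa using ha, by simpa using hb⟩
  have hspan := hli.span_eq_top_of_card_eq_finrank (by simp)
  have hv : v ∈ Submodule.span ℝ (Set.range ![u₁, u₂]) := hspan ▸ Submodule.mem_top
  rw [Matrix.range_cons_cons_empty, Submodule.mem_span_pair] at hv
  obtain ⟨s, t, h⟩ := hv
  exact ⟨s, t, h.symm⟩

/-- The structure equations of a surface with principal curvatures `0` and `b`, where `b` is
constant along its own principal direction: with `β = e₁b / b`, the frame `e₁, e₂` satisfies
`∇e₁ = -β e₂ ⊗ e₂*`, and `e₁β = β²`, `e₂β = 0`. -/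
theorem structure_equations {U : Set (ℝ × ℝ)} {x N : ℝ × ℝ → E3}
    (hS : SurfaceData U x N) {E₁ E₂ : ℝ × ℝ → ℝ × ℝ} {b : ℝ × ℝ → ℝ}
    (hE₁ : ContDiffOn ℝ (⊤ : ℕ∞) E₁ U) (hE₂ : ContDiffOn ℝ (⊤ : ℕ∞) E₂ U)
    (hon : ∀ p ∈ U,
      ⟪fderiv ℝ x p (E₁ p), fderiv ℝ x p (E₁ p)⟫_ℝ = 1 ∧
      ⟪fderiv ℝ x p (E₂ p), fderiv ℝ x p (E₂ p)⟫_ℝ = 1 ∧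
      ⟪fderiv ℝ x p (E₁ p), fderiv ℝ x p (E₂ p)⟫_ℝ = 0)
    (heig₁ : ∀ p ∈ U, fderiv ℝ N p (E₁ p) = 0)
    (heig₂ : ∀ p ∈ U, fderiv ℝ N p (E₂ p) = (-(b p)) • fderiv ℝ x p (E₂ p))
    (hb : ∀ p ∈ U, b p ≠ 0)
    (he₂b : ∀ p ∈ U, fderiv ℝ b p (E₂ p) = 0) :
    ContDiffOn ℝ (⊤ : ℕ∞) b U ∧ ∃ β : ℝ × ℝ → ℝ, ContDiffOn ℝ (⊤ : ℕ∞) β U ∧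
      ∀ p ∈ U, fderiv ℝ b p (E₁ p) = β p * b p ∧
        fderiv ℝ (fun q => fderiv ℝ x q (E₁ q)) p (E₁ p) = 0 ∧
        fderiv ℝ (fun q => fderiv ℝ x q (E₁ q)) p (E₂ p) = -(β p) • fderiv ℝ x p (E₂ p) ∧
        fderiv ℝ β p (E₁ p) = β p ^ 2 ∧ fderiv ℝ β p (E₂ p) = 0 := by
  have hU := hS.open_U
  let f₁ : ℝ × ℝ → E3 := fun q => fderiv ℝ x q (E₁ q)
  let f₂ : ℝ × ℝ → E3 := fun q => fderiv ℝ x q (E₂ q)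
  have hf₁ : ContDiffOn ℝ (⊤ : ℕ∞) f₁ U := hS.smooth_x.fderiv_apply_field hU hE₁
  have hf₂ : ContDiffOn ℝ (⊤ : ℕ∞) f₂ U := hS.smooth_x.fderiv_apply_field hU hE₂
  have h₁₁ : ∀ q ∈ U, ⟪f₁ q, f₁ q⟫_ℝ = 1 := fun q hq => (hon q hq).1
  have h₂₂ : ∀ q ∈ U, ⟪f₂ q, f₂ q⟫_ℝ = 1 := fun q hq => (hon q hq).2.1
  have h₁₂ : ∀ q ∈ U, ⟪f₁ q, f₂ q⟫_ℝ = 0 := fun q hq => (hon q hq).2.2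
  have hN₁ : ∀ q ∈ U, ⟪f₁ q, N q⟫_ℝ = 0 := fun q hq => by
    rw [real_inner_comm]; exact hS.normal_N q hq _
  have hN₂ : ∀ q ∈ U, ⟪f₂ q, N q⟫_ℝ = 0 := fun q hq => by
    rw [real_inner_comm]; exact hS.normal_N q hq _
  have hbs : ContDiffOn ℝ (⊤ : ℕ∞) b U := by
    refine ((hS.smooth_N.fderiv_apply_field hU hE₂).inner ℝ hf₂).neg.congr fun q hq => ?_
    have h : ⟪fderiv ℝ N q (E₂ q), f₂ q⟫_ℝ = -(b q) := by
      rw [heig₂ q hq, real_inner_smul_left, (hon q hq).2.1, mul_one]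
    rw [h, neg_neg]
  have hdiff : ∀ {G : Type} [NormedAddCommGroup G] [NormedSpace ℝ G] {f : ℝ × ℝ → G},
      ContDiffOn ℝ (⊤ : ℕ∞) f U → ∀ p ∈ U, DifferentiableAt ℝ f p := fun hf p hp =>
    (hf.contDiffAt (hU.mem_nhds hp)).differentiableAt (by simp)
  let β : ℝ × ℝ → ℝ := fun q => fderiv ℝ b q (E₁ q) / b q
  have hβs : ContDiffOn ℝ (⊤ : ℕ∞) β U := (hbs.fderiv_apply_field hU hE₁).div hbs hb
  have hβb : ∀ q ∈ U, fderiv ℝ b q (E₁ q) = β q * b q := fun q hq =>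
    (div_mul_cancel₀ _ (hb q hq)).symm
  -- the Codazzi equation
  have hcod : ∀ p ∈ U, VectorField.lieBracket ℝ E₁ E₂ p = β p • E₂ p ∧
      fderiv ℝ f₁ p (E₂ p) = -(β p) • f₂ p ∧ fderiv ℝ f₂ p (E₁ p) = 0 := by
    intro p hp
    obtain ⟨s, t, hst⟩ := exists_smul_add_smul_of_orthonormal_image (fderiv ℝ x p)
      (h₁₁ p hp) (h₂₂ p hp) (h₁₂ p hp) (VectorField.lieBracket ℝ E₁ E₂ p)
    have hbrN := fderiv_lieBracket_of_contDiffOn hU hS.smooth_N hE₁ hE₂ hp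
    have hbrx := fderiv_lieBracket_of_contDiffOn hU hS.smooth_x hE₁ hE₂ hp
    have hc₂ := Set.EqOn.fderiv_eq_of_isOpen hU (f := fun q => fderiv ℝ N q (E₂ q))
      (g := fun q => (-(b q)) • f₂ q) heig₂ hp
    have hc₁ := Set.EqOn.fderiv_eq_of_isOpen hU (f := fun q => fderiv ℝ N q (E₁ q))
      (g := fun _ => 0) heig₁ hp
    rw [hc₁, hc₂, fderiv_fun_smul (hdiff hbs.neg p hp) (hdiff hf₂ p hp), fderiv_fun_neg, hst]
      at hbrN
    simp only [map_add, map_smul, heig₁ p hp, heig₂ p hp, fderiv_fun_const] at hbrN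
    simp only [smul_zero, zero_add, add_apply,
      smul_apply, ContinuousLinearMap.smulRight_apply,
      neg_apply, Pi.zero_apply, zero_apply, sub_zero,
      hβb p hp] at hbrN
    change t • -(b p) • f₂ p = _ at hbrN
    have h22' := inner_fderiv_eq_zero_of_inner_self_eq_one hU hf₂ h₂₂ hp (E₁ p)
    have hin := congrArg (fun y => ⟪y, f₂ p⟫_ℝ) hbrN
    simp only [inner_add_left, real_inner_smul_left, h22', h₂₂ p hp] at hin
    have htβ : t = β p := by
      apply mul_right_cancel₀ (hb p hp)
      linarith
    have h12f : fderiv ℝ f₂ p (E₁ p) = 0 := by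
      have : (b p) • fderiv ℝ f₂ p (E₁ p) = 0 := by
        rw [htβ] at hbrN
        linear_combination (norm := module) hbrN
      exact (smul_eq_zero.1 this).resolve_left (hb p hp)
    rw [hst] at hbrx
    change _ = fderiv ℝ f₂ p (E₁ p) - fderiv ℝ f₁ p (E₂ p) at hbrx
    rw [h12f, map_add, map_smul, map_smul] at hbrx
    change s • f₁ p + t • f₂ p = _ at hbrx
    have h11' := inner_fderiv_eq_zero_of_inner_self_eq_one hU hf₁ h₁₁ hp (E₂ p)
    have hin := congrArg (fun y => ⟪y, f₁ p⟫_ℝ) hbrx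
    have h21 : ⟪f₂ p, f₁ p⟫_ℝ = 0 := by rw [real_inner_comm]; exact h₁₂ p hp
    simp only [inner_add_left, inner_sub_left, real_inner_smul_left, h11', h₁₁ p hp, h21,
      inner_zero_left] at hin
    have hs : s = 0 := by linarith
    rw [hs, htβ] at hbrx hst
    refine ⟨by simpa using hst, ?_, h12f⟩
    linear_combination (norm := module) hbrx
  have h11f : ∀ p ∈ U, fderiv ℝ f₁ p (E₁ p) = 0 := by
    intro p hp
    refine eq_zero_of_inner_orthonormal_eq_zero (a := f₁ p) (b := f₂ p) (c := N p) ?_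
      (inner_fderiv_eq_zero_of_inner_self_eq_one hU hf₁ h₁₁ hp _) ?_ ?_
    · refine ⟨fun i => ?_, fun i j hij => ?_⟩
      · fin_cases i
        · exact norm_eq_one_of_real_inner_self (h₁₁ p hp)
        · exact norm_eq_one_of_real_inner_self (h₂₂ p hp)
        · exact hS.unit_N p hp
      · fin_cases i <;> fin_cases j <;>
          simp [h₁₂ p hp, hN₁ p hp, hN₂ p hp, real_inner_comm (f₁ p), real_inner_comm (f₂ p)]
            at hij ⊢
    · rw [inner_fderiv_eq_neg_of_inner_eq_zero hU hf₁ hf₂ h₁₂ hp, (hcod p hp).2.2]; simp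
    · rw [inner_fderiv_eq_neg_of_inner_eq_zero hU hf₁ hS.smooth_N hN₁ hp, heig₁ p hp]; simp
  refine ⟨hbs, β, hβs, fun p hp => ⟨hβb p hp, h11f p hp, (hcod p hp).2.1, ?_, ?_⟩⟩
  · -- the Gauss equation
    have hbr := fderiv_lieBracket_of_contDiffOn hU hf₁ hE₁ hE₂ hp
    rw [Set.EqOn.fderiv_eq_of_isOpen hU (f := fun q => fderiv ℝ f₁ q (E₁ q))
        (g := fun _ => 0) h11f hp,
      Set.EqOn.fderiv_eq_of_isOpen hU (f := fun q => fderiv ℝ f₁ q (E₂ q))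
        (g := fun q => (-(β q)) • f₂ q) (fun q hq => (hcod q hq).2.1) hp,
      fderiv_fun_smul (hdiff hβs.neg p hp) (hdiff hf₂ p hp), fderiv_fun_neg, (hcod p hp).1,
      map_smul, (hcod p hp).2.1] at hbr
    have hin := congrArg (fun y => ⟪y, f₂ p⟫_ℝ) hbr
    have hn : ‖f₂ p‖ = 1 := norm_eq_one_of_real_inner_self (h₂₂ p hp)
    simp [real_inner_smul_left, hn, (hcod p hp).2.2] at hin
    linarith
  · have hbr := fderiv_lieBracket_of_contDiffOn hU hbs hE₁ hE₂ hp
    rw [Set.EqOn.fderiv_eq_of_isOpen hU (f := fun q => fderiv ℝ b q (E₂ q))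
        (g := fun _ => 0) he₂b hp,
      Set.EqOn.fderiv_eq_of_isOpen hU (f := fun q => fderiv ℝ b q (E₁ q))
        (g := fun q => β q * b q) hβb hp,
      fderiv_fun_mul (hdiff hβs p hp) (hdiff hbs p hp), (hcod p hp).1, map_smul, he₂b p hp]
      at hbr
    simpa [he₂b p hp, hb p hp] using hbr

/-- The apex, the axis and the opening of the cone are constant along the surface. -/
theorem exists_apex_axis {U : Set (ℝ × ℝ)} {x N : ℝ × ℝ → E3}
    (hS : SurfaceData U x N) {E₁ E₂ : ℝ × ℝ → ℝ × ℝ} {b : ℝ × ℝ → ℝ}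
    (hE₁ : ContDiffOn ℝ (⊤ : ℕ∞) E₁ U) (hE₂ : ContDiffOn ℝ (⊤ : ℕ∞) E₂ U)
    (hon : ∀ p ∈ U,
      ⟪fderiv ℝ x p (E₁ p), fderiv ℝ x p (E₁ p)⟫_ℝ = 1 ∧
      ⟪fderiv ℝ x p (E₂ p), fderiv ℝ x p (E₂ p)⟫_ℝ = 1 ∧
      ⟪fderiv ℝ x p (E₁ p), fderiv ℝ x p (E₂ p)⟫_ℝ = 0)
    (heig₁ : ∀ p ∈ U, fderiv ℝ N p (E₁ p) = 0)
    (heig₂ : ∀ p ∈ U, fderiv ℝ N p (E₂ p) = (-(b p)) • fderiv ℝ x p (E₂ p))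
    (hb : ∀ p ∈ U, b p ≠ 0)
    (he₂b : ∀ p ∈ U, fderiv ℝ b p (E₂ p) = 0)
    (he₁b : ∀ p ∈ U, fderiv ℝ b p (E₁ p) ≠ 0) :
    ∃ β : ℝ × ℝ → ℝ, ContinuousOn β U ∧ (∀ p ∈ U, β p ≠ 0) ∧
      ∃ (c w : E3) (k : ℝ), k ≠ 0 ∧ ∀ p ∈ U,
        x p - c = -(β p)⁻¹ • fderiv ℝ x p (E₁ p) ∧ w = fderiv ℝ x p (E₁ p) - k • N p := by
  have hU := hS.open_U
  obtain ⟨hbs, β, hβs, hβ⟩ := structure_equations hS hE₁ hE₂ hon heig₁ heig₂ hb he₂b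
  have hβ₀ : ∀ p ∈ U, β p ≠ 0 := fun p hp h => he₁b p hp (by rw [(hβ p hp).1, h, zero_mul])
  let f₁ : ℝ × ℝ → E3 := fun q => fderiv ℝ x q (E₁ q)
  have hf₁ : ContDiffOn ℝ (⊤ : ℕ∞) f₁ U := hS.smooth_x.fderiv_apply_field hU hE₁
  have hdiff : ∀ {G : Type} [NormedAddCommGroup G] [NormedSpace ℝ G] {f : ℝ × ℝ → G},
      ContDiffOn ℝ (⊤ : ℕ∞) f U → ∀ p ∈ U, DifferentiableAt ℝ f p := fun hf p hp =>
    (hf.contDiffAt (hU.mem_nhds hp)).differentiableAt (by simp)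
  have hconst : ∀ {G : Type} [NormedAddCommGroup G] [NormedSpace ℝ G] {f : ℝ × ℝ → G},
      ContDiffOn ℝ (⊤ : ℕ∞) f U → (∀ p ∈ U, fderiv ℝ f p (E₁ p) = 0) →
      (∀ p ∈ U, fderiv ℝ f p (E₂ p) = 0) → ∃ a, ∀ p ∈ U, f p = a := by
    intro G _ _ f hf h₁ h₂
    refine hU.exists_is_const_of_fderiv_eq_zero (𝕜 := ℝ) hS.conn_U.isPreconnected
      (fun p hp => (hdiff hf p hp).differentiableWithinAt) fun p hp => ?_
    refine ContinuousLinearMap.ext fun v => ?_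
    obtain ⟨s, t, rfl⟩ := exists_smul_add_smul_of_orthonormal_image (fderiv ℝ x p)
      (hon p hp).1 (hon p hp).2.1 (hon p hp).2.2 v
    simp only [map_add, map_smul, h₁ p hp, h₂ p hp, smul_zero, Pi.zero_apply, add_zero,
      zero_apply]
  have hinv : ∀ {g : ℝ × ℝ → ℝ}, ContDiffOn ℝ (⊤ : ℕ∞) g U → ∀ p ∈ U, g p ≠ 0 → ∀ v,
      fderiv ℝ (fun q => (g q)⁻¹) p v = -(fderiv ℝ g p v) / g p ^ 2 := by
    intro g hg p hp hgp v
    have h := (hasDerivAt_inv hgp).comp_hasFDerivAt p (hdiff hg p hp).hasFDerivAt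
    change fderiv ℝ ((fun y : ℝ => y⁻¹) ∘ g) p v = _
    rw [h.fderiv, smul_apply, smul_eq_mul]
    ring
  have hquot : ∀ p ∈ U, ∀ v, fderiv ℝ (fun q => β q * (b q)⁻¹) p v =
      (fderiv ℝ β p v * b p - β p * fderiv ℝ b p v) / b p ^ 2 := by
    intro p hp v
    rw [fderiv_fun_mul (hdiff hβs p hp) (hdiff (f := fun q => (b q)⁻¹) (hbs.inv hb) p hp)]
    simp only [add_apply, smul_apply, smul_eq_mul, hinv hbs p hp (hb p hp)]
    have := hb p hp
    field_simp
    ring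
  obtain ⟨k, hk⟩ := hconst (f := fun q => β q * (b q)⁻¹) (hβs.mul (hbs.inv hb))
    (fun p hp => by
      rw [hquot p hp, (hβ p hp).1, (hβ p hp).2.2.2.1]
      ring)
    (fun p hp => by
      rw [hquot p hp, he₂b p hp, (hβ p hp).2.2.2.2]
      ring)
  obtain ⟨c, hc⟩ := hconst (f := fun q => x q + (β q)⁻¹ • f₁ q)
    (hS.smooth_x.add ((hβs.inv hβ₀).smul hf₁))
    (fun p hp => by
      rw [fderiv_fun_add (hdiff hS.smooth_x p hp)
          (hdiff (f := fun q => (β q)⁻¹ • f₁ q) ((hβs.inv hβ₀).smul hf₁) p hp),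
        fderiv_fun_smul (hdiff (f := fun q => (β q)⁻¹) (hβs.inv hβ₀) p hp) (hdiff hf₁ p hp)]
      have h := hβ₀ p hp
      simp only [add_apply, smul_apply, ContinuousLinearMap.smulRight_apply, hinv hβs p hp h,
        (hβ p hp).2.1, (hβ p hp).2.2.2.1, f₁]
      rw [neg_div, div_self (pow_ne_zero 2 h)]
      simp)
    (fun p hp => by
      rw [fderiv_fun_add (hdiff hS.smooth_x p hp)
          (hdiff (f := fun q => (β q)⁻¹ • f₁ q) ((hβs.inv hβ₀).smul hf₁) p hp),
        fderiv_fun_smul (hdiff (f := fun q => (β q)⁻¹) (hβs.inv hβ₀) p hp) (hdiff hf₁ p hp)]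
      have h := hβ₀ p hp
      simp only [add_apply, smul_apply, ContinuousLinearMap.smulRight_apply, hinv hβs p hp h,
        (hβ p hp).2.2.1, (hβ p hp).2.2.2.2, f₁]
      simp [smul_smul, h])
  obtain ⟨w, hw⟩ := hconst (f := fun q => f₁ q - k • N q)
    (hf₁.sub (hS.smooth_N.const_smul k))
    (fun p hp => by
      rw [fderiv_fun_sub (hdiff hf₁ p hp)
          (hdiff (f := fun q => k • N q) (hS.smooth_N.const_smul k) p hp),
        fderiv_fun_const_smul (hdiff hS.smooth_N p hp)]
      simp [f₁, (hβ p hp).2.1, heig₁ p hp])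
    (fun p hp => by
      rw [fderiv_fun_sub (hdiff hf₁ p hp)
          (hdiff (f := fun q => k • N q) (hS.smooth_N.const_smul k) p hp),
        fderiv_fun_const_smul (hdiff hS.smooth_N p hp)]
      simp [f₁, (hβ p hp).2.2.1, heig₂ p hp, ← hk p hp, smul_smul, hb p hp])
  obtain ⟨p₀, hp₀⟩ := hS.conn_U.nonempty
  refine ⟨β, hβs.continuousOn, hβ₀, c, w, k, ?_, fun p hp => ⟨?_, (hw p hp).symm⟩⟩
  · rw [← hk p₀ hp₀]
    exact mul_ne_zero (hβ₀ p₀ hp₀) (inv_ne_zero (hb p₀ hp₀))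
  · rw [← hc p hp]
    simp [f₁]

/-- A surface with principal curvatures `0` and `b`, where `b` is nowhere
zero, constant along its own principal direction (`e₂b ≡ 0`) and with `e₁b` nowhere zero,
is locally congruent to a part of a circular cone `C_r`. -/
theorem flat_surface_is_cone (U : Set (ℝ × ℝ)) (x N : ℝ × ℝ → E3)
    (hS : SurfaceData U x N) (E₁ E₂ : ℝ × ℝ → ℝ × ℝ) (b : ℝ × ℝ → ℝ)
    (hE₁ : ContDiffOn ℝ (⊤ : ℕ∞) E₁ U) (hE₂ : ContDiffOn ℝ (⊤ : ℕ∞) E₂ U)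
    (hon : ∀ p ∈ U,
      ⟪fderiv ℝ x p (E₁ p), fderiv ℝ x p (E₁ p)⟫_ℝ = 1 ∧
      ⟪fderiv ℝ x p (E₂ p), fderiv ℝ x p (E₂ p)⟫_ℝ = 1 ∧
      ⟪fderiv ℝ x p (E₁ p), fderiv ℝ x p (E₂ p)⟫_ℝ = 0)
    (heig₁ : ∀ p ∈ U, fderiv ℝ N p (E₁ p) = 0)
    (heig₂ : ∀ p ∈ U, fderiv ℝ N p (E₂ p) = (-(b p)) • fderiv ℝ x p (E₂ p))
    (hb : ∀ p ∈ U, b p ≠ 0)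
    (he₂b : ∀ p ∈ U, fderiv ℝ b p (E₂ p) = 0)
    (he₁b : ∀ p ∈ U, fderiv ℝ b p (E₁ p) ≠ 0) :
    ∀ p ∈ U, ∃ V : Set (ℝ × ℝ), IsOpen V ∧ p ∈ V ∧ V ⊆ U ∧
      ∃ r : ℝ, r ≠ 0 ∧ ∃ Φ : E3 → E3, RigidMotion Φ ∧ ∀ q ∈ V, Φ (x q) ∈ coneSet r := by
  intro p hp
  obtain ⟨β, hβc, hβ₀, c, w, k, hk, h⟩ :=
    exists_apex_axis hS hE₁ hE₂ hon heig₁ heig₂ hb he₂b he₁b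
  obtain ⟨σ, hσ, hσp⟩ : ∃ σ : ℝ, σ ^ 2 = 1 ∧ σ * β p < 0 := by
    rcases lt_or_gt_of_ne (hβ₀ p hp) with hneg | hpos
    · exact ⟨1, by norm_num, by linarith⟩
    · exact ⟨-1, by norm_num, by linarith⟩
  have hkpos : 0 < k ^ 2 + 1 := by positivity
  have hperp : ∀ q ∈ U, ⟪N q, fderiv ℝ x q (E₁ q)⟫_ℝ = 0 := fun q hq => hS.normal_N q hq _
  have hww : ‖w‖ ^ 2 = k ^ 2 + 1 := by
    rw [(h p hp).2, norm_sub_sq_real, real_inner_smul_right, real_inner_comm, hperp p hp,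
      norm_smul, hS.unit_N p hp, ← real_inner_self_eq_norm_sq, (hon p hp).1]
    simp
    ring
  have hσa : |σ| = 1 := by rwa [← sq_eq_sq₀ (abs_nonneg σ) zero_le_one, sq_abs, one_pow]
  have hwn : ‖(σ / Real.sqrt (k ^ 2 + 1)) • w‖ = 1 := by
    rw [norm_smul, norm_div, Real.norm_eq_abs, hσa, ← hww, Real.sqrt_sq (norm_nonneg w),
      norm_norm]
    have : ‖w‖ ≠ 0 := fun h0 => by rw [h0] at hww; linarith
    field_simp
  obtain ⟨S, hdet, hS₂⟩ := exists_rotation_third_coord _ hwn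
  refine ⟨U ∩ (fun q => σ * β q) ⁻¹' Set.Iio 0,
    (continuousOn_const.mul hβc).isOpen_inter_preimage hS.open_U isOpen_Iio, ⟨hp, hσp⟩,
    Set.inter_subset_left, |k|, abs_ne_zero.2 hk, fun y => S y + S (-c),
    ⟨S, S (-c), hdet, fun _ => rfl⟩, fun q hq => ?_⟩
  obtain ⟨hqU, hqσ⟩ := hq
  replace hqσ : σ * β q < 0 := hqσ
  have hβq := hβ₀ q hqU
  have hs : 0 < -(σ * (β q)⁻¹) := by
    have : σ * (β q)⁻¹ = σ * β q * ((β q)⁻¹) ^ 2 := by field_simp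
    rw [this]
    have : 0 < ((β q)⁻¹) ^ 2 := by positivity
    nlinarith
  change S (x q) + S (-c) ∈ coneSet |k|
  rw [← map_add, ← sub_eq_add_neg]
  have hn : ‖fderiv ℝ x q (E₁ q)‖ = 1 := norm_eq_one_of_real_inner_self (hon q hqU).1
  refine mem_coneSet_of_norm_eq (abs_pos.2 hk) hs ?_ ?_
  · rw [S.norm_map, (h q hqU).1, norm_smul, hn, mul_one, ← abs_of_pos hs, Real.norm_eq_abs,
      abs_neg, abs_neg, abs_mul, hσa, one_mul]
  · rw [hS₂, (h q hqU).1, (h q hqU).2, sq_abs, real_inner_smul_left, real_inner_smul_right,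
      inner_sub_left, real_inner_smul_left, hperp q hqU, (hon q hqU).1]
    ring
end
end
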